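/- arXiv:1808.01579 — 2 statements merged into one kernel-verified Lean document; each statement's English description precedes it below -/
import Mathlib

section
/- Let F be a field, let n be a positive integer, and let A ∈ GL_n(F) have determinant 1 or −1. Then the augmented matrix A ⊕ I_n ∈ GL_{2n}(F) (block-diagonal with blocks A and the n×n identity) can be written as a product of three involutions of GL_{2n}(F). -/
section

open Polynomial

/-- `g` is inverted under conjugation by some `j` with `j * j = 1`. -/
def IsStronglyReversible {G : Type*} [Monoid G] (g : G) : Prop :=
  ∃ j : G, j * j = 1 ∧ j * g * (j * g) = 1

/-- `g` is a product of three elements that square to `1`. -/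
def IsProdThreeInvolutions {G : Type*} [Monoid G] (g : G) : Prop :=
  ∃ a b c : G, a * a = 1 ∧ b * b = 1 ∧ c * c = 1 ∧ g = a * b * c

section Monoid

variable {G H : Type*} [Monoid G] [Monoid H]

theorem IsStronglyReversible.map {g : G} (hg : IsStronglyReversible g) (φ : G →* H) :
    IsStronglyReversible (φ g) := by
  obtain ⟨j, h₁, h₂⟩ := hg
  exact ⟨φ j, by rw [← map_mul, h₁, map_one], by simp only [← map_mul, h₂, map_one]⟩

theorem IsProdThreeInvolutions.map {g : G} (hg : IsProdThreeInvolutions g) (φ : G →* H) :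
    IsProdThreeInvolutions (φ g) := by
  obtain ⟨a, b, c, ha, hb, hc, rfl⟩ := hg
  exact ⟨φ a, φ b, φ c, by rw [← map_mul, ha, map_one], by rw [← map_mul, hb, map_one],
    by rw [← map_mul, hc, map_one], by simp only [map_mul]⟩

theorem IsProdThreeInvolutions.prod {g : G} {h : H} (hg : IsProdThreeInvolutions g)
    (hh : IsProdThreeInvolutions h) : IsProdThreeInvolutions (g, h) := by
  obtain ⟨a, b, c, ha, hb, hc, rfl⟩ := hg
  obtain ⟨a', b', c', ha', hb', hc', rfl⟩ := hh
  exact ⟨(a, a'), (b, b'), (c, c'), by simp [ha, ha'], by simp [hb, hb'], by simp [hc, hc'],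
    by simp⟩

theorem IsStronglyReversible.involution_mul {s g : G} (hs : s * s = 1)
    (hg : IsStronglyReversible g) : IsProdThreeInvolutions (s * g) := by
  obtain ⟨j, h₁, h₂⟩ := hg
  exact ⟨s, j, j * g, hs, h₁, h₂, by rw [mul_assoc, ← mul_assoc j j g, h₁, one_mul]⟩

theorem IsStronglyReversible.isProdThreeInvolutions {g : G} (hg : IsStronglyReversible g) :
    IsProdThreeInvolutions g := by
  simpa using hg.involution_mul (one_mul 1)

end Monoid

section Reciprocal

variable {F : Type*} [Field F]

/-- The root multiset of `p` in a splitting field avoids `0` and is stable under inversion. -/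
def Polynomial.IsReciprocal (p : F[X]) : Prop :=
  p.coeff 0 ≠ 0 ∧ p ∣ p.reverse

namespace Polynomial.IsReciprocal

theorem mul {p q : F[X]} (hp : p.IsReciprocal) (hq : q.IsReciprocal) : (p * q).IsReciprocal :=
  ⟨by rw [mul_coeff_zero]; exact mul_ne_zero hp.1 hq.1, by
    rw [reverse_mul_of_domain]; exact mul_dvd_mul hp.2 hq.2⟩

theorem C {a : F} (ha : a ≠ 0) : (Polynomial.C a).IsReciprocal :=
  ⟨by simpa using ha, by simp⟩

theorem one : (1 : F[X]).IsReciprocal := by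
  simpa using C (one_ne_zero : (1 : F) ≠ 0)

theorem pow {p : F[X]} (hp : p.IsReciprocal) (n : ℕ) : (p ^ n).IsReciprocal := by
  induction n with
  | zero => simpa using one
  | succ n ih => rw [pow_succ]; exact ih.mul hp

theorem prod {ι : Type*} (s : Finset ι) (p : ι → F[X]) (hp : ∀ i ∈ s, (p i).IsReciprocal) :
    (∏ i ∈ s, p i).IsReciprocal := by
  classical
  induction s using Finset.induction_on with
  | empty => simpa using one
  | insert a s ha ih =>
    rw [Finset.prod_insert ha]
    exact (hp a (by simp)).mul (ih fun i hi => hp i (by simp [hi]))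

theorem reverse_X_sub_C {a : F} (ha : a ≠ 0) :
    (X - Polynomial.C a).reverse = Polynomial.C (-a) * (X - Polynomial.C a⁻¹) := by
  rw [mul_sub, ← Polynomial.C_mul, neg_mul, mul_inv_cancel₀ ha]
  ext n
  rcases n with _ | _ | n
  · simp
  · rw [coeff_reverse]
    simp [revAt, coeff_one]
  · rw [coeff_eq_zero_of_natDegree_lt]
    · simp [coeff_one]
    · exact (reverse_natDegree_le _).trans_lt (by rw [natDegree_X_sub_C]; omega)

theorem X_sub_C {a : F} (ha : a * a = 1) : (X - Polynomial.C a).IsReciprocal := by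
  have h0 : a ≠ 0 := by rintro rfl; simp at ha
  refine ⟨by simpa using h0, ?_⟩
  rw [reverse_X_sub_C h0, inv_eq_of_mul_eq_one_left ha]
  exact dvd_mul_left _ _

theorem X_sub_C_mul {a : F} (ha : a ≠ 0) :
    ((X - Polynomial.C a⁻¹) * (X - Polynomial.C a)).IsReciprocal := by
  refine ⟨by simp [ha], ?_⟩
  rw [reverse_mul_of_domain, reverse_X_sub_C ha, reverse_X_sub_C (inv_ne_zero ha), inv_inv]
  exact ⟨Polynomial.C (-a⁻¹) * Polynomial.C (-a), by ring⟩

/-- Multiplication by `X` on `F[X] ⧸ (p)` is strongly reversible when `p` is reciprocal. -/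
theorem exists_inverting {p : F[X]} (hp : p.IsReciprocal) :
    ∃ j : (F[X] ⧸ Submodule.span F[X] {p}) →ₗ[F] (F[X] ⧸ Submodule.span F[X] {p}),
      ∀ x, j (j x) = x ∧ j ((X : F[X]) • j ((X : F[X]) • x)) = x := by
  let I : Ideal F[X] := Ideal.span {p}
  let x : F[X] ⧸ I := Ideal.Quotient.mk I X
  have hx : IsUnit x := by
    have : IsCoprime X p := by
      rw [(prime_X).coprime_iff_not_dvd, X_dvd_iff]
      exact hp.1
    obtain ⟨u, v, huv⟩ := this
    refine IsUnit.of_mul_eq_one (Ideal.Quotient.mk I u) ?_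
    rw [← map_mul, ← map_one (Ideal.Quotient.mk I), Ideal.Quotient.eq, Ideal.mem_span_singleton]
    exact ⟨-v, by linear_combination huv⟩
  obtain ⟨u, hu⟩ := hx
  let y : F[X] ⧸ I := ↑u⁻¹
  have hxy : x * y = 1 := by rw [← hu]; exact u.mul_inv
  have aeval_x : ∀ q : F[X], aeval x q = Ideal.Quotient.mk I q := fun q => by
    have := aeval_algHom_apply (Ideal.Quotient.mkₐ F I) X q
    simpa using this
  have hy : aeval y p = 0 := by
    let _ : Invertible y := ⟨x, hxy, by rw [mul_comm]; exact hxy⟩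
    have h := eval₂_reverse_mul_pow (algebraMap F (F[X] ⧸ I)) y p
    rw [aeval_def, ← h]
    have : ⅟y = x := rfl
    rw [this, ← aeval_def, aeval_x, Ideal.Quotient.eq_zero_iff_mem.2, zero_mul]
    exact Ideal.mem_span_singleton.2 hp.2
  let φ : (F[X] ⧸ I) →ₐ[F] (F[X] ⧸ I) := Ideal.Quotient.liftₐ I (aeval y) (by
    intro a ha
    obtain ⟨b, rfl⟩ := Ideal.mem_span_singleton.1 ha
    simp [hy])
  have hφx : φ x = y := aeval_X y
  have hφy : φ y = x := by
    have h : φ x * φ y = 1 := by rw [← map_mul, hxy, map_one]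
    rw [hφx] at h
    calc φ y = x * y * φ y := by rw [hxy, one_mul]
      _ = x := by rw [mul_assoc, h, mul_one]
  have hφ : ∀ z, φ (φ z) = z := by
    have : φ.comp φ = AlgHom.id F _ := by
      apply Ideal.Quotient.algHom_ext
      ext
      change φ (φ x) = x
      rw [hφx, hφy]
    exact fun z => congrArg (fun f => f z) this
  refine ⟨φ.toLinearMap, fun z => ⟨hφ z, ?_⟩⟩
  have hsmul : ∀ w : F[X] ⧸ I, (X : F[X]) • w = x * w := fun w => by
    obtain ⟨w, rfl⟩ := Ideal.Quotient.mk_surjective w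
    rfl
  change φ ((X : F[X]) • φ ((X : F[X]) • z)) = z
  rw [hsmul, hsmul, map_mul, map_mul, map_mul, hφx, hφy, hφ, ← mul_assoc, mul_comm y x, hxy,
    one_mul]

end Polynomial.IsReciprocal

end Reciprocal

section EndomorphismReversibility

variable {F V : Type*} [Field F] [AddCommGroup V] [Module F V]

/-- An operator whose cyclic components have reciprocal moduli is strongly reversible. -/
theorem isStronglyReversible_of_directSum {ι : Type*} [Fintype ι] (N : Module.End F V)
    (p : ι → F[X]) (hp : ∀ i, (p i).IsReciprocal)
    (e : V ≃ₗ[F] Π i, F[X] ⧸ Submodule.span F[X] {p i})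
    (he : ∀ v, e (N v) = (X : F[X]) • e v) : IsStronglyReversible N := by
  choose j hj using fun i => (hp i).exists_inverting
  let J : (Π i, F[X] ⧸ Submodule.span F[X] {p i}) →ₗ[F] Π i, F[X] ⧸ Submodule.span F[X] {p i} :=
    LinearMap.pi fun i => j i ∘ₗ LinearMap.proj i
  refine ⟨e.symm.toLinearMap ∘ₗ J ∘ₗ e.toLinearMap, ?_, ?_⟩
  · ext v
    apply e.injective
    ext i
    simp [J, (hj i _).1]
  · ext v
    apply e.injective
    ext i
    simp [J, he, (hj i _).2]

theorem isStronglyReversible_of_cyclic [FiniteDimensional F V] (N : Module.End F V) (v : V)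
    (hv : ∀ w, ∃ q : F[X], aeval N q v = w) (p : F[X]) (hp : p.IsReciprocal)
    (hN : aeval N p = 0) (hdeg : p.natDegree = Module.finrank F V) : IsStronglyReversible N := by
  have hp0 : p ≠ 0 := by
    rintro rfl
    exact hp.1 (coeff_zero 0)
  let f₀ : F[X] →ₗ[F] V := (LinearMap.applyₗ v) ∘ₗ (aeval N).toLinearMap
  have hker : (Submodule.span F[X] {p}).restrictScalars F ≤ LinearMap.ker f₀ := by
    intro q hq
    obtain ⟨r, rfl⟩ := Ideal.mem_span_singleton.1 hq
    simp [f₀, hN]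
  let f : (F[X] ⧸ Submodule.span F[X] {p}) →ₗ[F] V :=
    Submodule.liftQ ((Submodule.span F[X] {p}).restrictScalars F) f₀ hker
  have hf : ∀ q : F[X], f (Submodule.Quotient.mk q) = aeval N q v := fun q => rfl
  have hsurj : Function.Surjective f := fun w => by
    obtain ⟨q, hq⟩ := hv w
    exact ⟨Submodule.Quotient.mk q, by rw [hf, hq]⟩
  have hdim : Module.finrank F (F[X] ⧸ Submodule.span F[X] {p}) = Module.finrank F V := by
    rw [← hdeg]
    exact finrank_quotient_span_eq_natDegree
  have : Module.Finite F (F[X] ⧸ Submodule.span F[X] {p}) :=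
    (AdjoinRoot.powerBasis hp0).finite
  have hinj : Function.Injective f :=
    (LinearMap.injective_iff_surjective_of_finrank_eq_finrank hdim).2 hsurj
  let e := LinearEquiv.ofBijective f ⟨hinj, hsurj⟩
  refine isStronglyReversible_of_directSum N (fun _ : Unit => p) (fun _ => hp)
    (e.symm.trans (LinearEquiv.funUnique Unit F _).symm) fun w => ?_
  obtain ⟨x, rfl⟩ := e.surjective w
  obtain ⟨q, rfl⟩ := Submodule.Quotient.mk_surjective _ x
  have : N (e (Submodule.Quotient.mk q)) = e ((X : F[X]) • Submodule.Quotient.mk q) := by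
    change N (f _) = f (Submodule.Quotient.mk (X * q))
    rw [hf, hf]
    simp
  rw [this]
  ext i
  simp

theorem isReciprocal_pow_of_dvd {p : F[X]} (hp : Irreducible p) {e k : ℕ}
    (h : p ^ e ∣ (X ^ 2 - 1) ^ k) : (p ^ e).IsReciprocal := by
  rcases Nat.eq_zero_or_pos e with rfl | he
  · simpa using Polynomial.IsReciprocal.one
  refine Polynomial.IsReciprocal.pow ?_ e
  have h1 : p ∣ (X - C 1) * (X - C (-1)) := by
    have h2 := hp.prime.dvd_of_dvd_pow ((dvd_pow_self p he.ne').trans h)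
    convert h2 using 1
    simp
    ring
  have key : ∀ c : F, c * c = 1 → p ∣ X - C c → p.IsReciprocal := by
    intro c hc hd
    obtain ⟨u, hu⟩ := (hp.associated_of_dvd (irreducible_X_sub_C c) hd).symm
    obtain ⟨a, ha, hau⟩ := Polynomial.isUnit_iff.1 u.isUnit
    rw [← hu, ← hau]
    exact (Polynomial.IsReciprocal.X_sub_C hc).mul (Polynomial.IsReciprocal.C ha.ne_zero)
  rcases hp.prime.dvd_or_dvd h1 with h | h
  · exact key 1 (by simp) h
  · exact key (-1) (by simp) h

theorem isStronglyReversible_of_isNilpotent [FiniteDimensional F V] (N : Module.End F V)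
    (hN : IsNilpotent (N ^ 2 - 1)) : IsStronglyReversible N := by
  obtain ⟨k, hk⟩ := hN
  obtain ⟨ι, _, p, hp, m, ⟨e⟩⟩ := Module.equiv_directSum_of_isTorsion
    (Module.AEval.isTorsion_of_finiteDimensional F V N)
  classical
  let e' : V ≃ₗ[F] Π i, F[X] ⧸ Submodule.span F[X] {p i ^ m i} :=
    (Module.AEval.of F V N).trans
      ((e.trans (DirectSum.linearEquivFunOnFintype F[X] ι _)).restrictScalars F)
  have he' : ∀ (q : F[X]) v, e' (aeval N q v) = q • e' v := fun q v =>
    (e.trans (DirectSum.linearEquivFunOnFintype F[X] ι _)).map_smul q (Module.AEval.of F V N v)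
  refine isStronglyReversible_of_directSum N (fun i => p i ^ m i) (fun i => ?_) e' fun v => ?_
  · refine isReciprocal_pow_of_dvd (hp i) (k := k) ?_
    obtain ⟨v, hv⟩ := e'.surjective (Pi.single i (Submodule.Quotient.mk 1))
    have h := he' ((X ^ 2 - 1) ^ k) v
    have h0 : aeval N (((X : F[X]) ^ 2 - 1) ^ k) = 0 := by simp [hk]
    rw [h0, hv] at h
    have h2 := congrFun h i
    simp only [LinearMap.zero_apply, map_zero, Pi.zero_apply, Pi.smul_apply, Pi.single_eq_same]
      at h2
    rw [← Submodule.Quotient.mk_smul, eq_comm, Submodule.Quotient.mk_eq_zero] at h2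
    simpa using Ideal.mem_span_singleton.1 h2
  · simpa using he' X v

end EndomorphismReversibility

section Companion

variable {F V W : Type*} [Field F] [AddCommGroup V] [Module F V] [AddCommGroup W] [Module F W]

theorem IsProdThreeInvolutions.of_conj {g : Module.End F V} {h : Module.End F W} (e : V ≃ₗ[F] W)
    (he : ∀ v, e (g v) = h (e v)) (hh : IsProdThreeInvolutions h) : IsProdThreeInvolutions g := by
  have := hh.map (e.symm.conjRingEquiv : Module.End F W →* Module.End F V)
  convert this using 1
  ext v
  simp [← he]

theorem IsStronglyReversible.of_conj {g : Module.End F V} {h : Module.End F W} (e : V ≃ₗ[F] W)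
    (he : ∀ v, e (g v) = h (e v)) (hh : IsStronglyReversible h) : IsStronglyReversible g := by
  have := hh.map (e.symm.conjRingEquiv : Module.End F W →* Module.End F V)
  convert this using 1
  ext v
  simp [← he]

theorem IsProdThreeInvolutions.prodMap {f : Module.End F V} {g : Module.End F W}
    (hf : IsProdThreeInvolutions f) (hg : IsProdThreeInvolutions g) :
    IsProdThreeInvolutions (f.prodMap g : Module.End F (V × W)) :=
  (hf.prod hg).map (LinearMap.prodMapRingHom F V W : _ →* Module.End F (V × W))

/-- The companion operator of the quadratic operator polynomial `t ^ 2 - t B - f`. -/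
def quadraticCompanion (f B : Module.End F V) : Module.End F (V × V) :=
  (f ∘ₗ LinearMap.snd F V V).prod (LinearMap.fst F V V + B ∘ₗ LinearMap.snd F V V)

@[simp]
theorem quadraticCompanion_apply (f B : Module.End F V) (x : V × V) :
    quadraticCompanion f B x = (f x.2, x.1 + B x.2) := rfl

theorem isProdThreeInvolutions_prodMap_of_quadraticCompanion {f B : Module.End F V}
    (hf : IsUnit (f - 1)) (h : IsStronglyReversible (quadraticCompanion f B)) :
    IsProdThreeInvolutions (f.prodMap (1 : Module.End F V)) := by
  obtain ⟨u, hu⟩ := hf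
  let K : Module.End F V := B * ↑u⁻¹
  have hK : ∀ y, K (f y) - K y = B y := fun y => by
    have : K * (f - 1) = B := by rw [← hu]; simp [K, mul_assoc]
    rw [← this]
    simp
  let s : Module.End F (V × V) := (LinearEquiv.prodComm F V V).toLinearMap
  have hs : s * s = 1 := by ext <;> simp [s]
  let e : (V × V) ≃ₗ[F] V × V := LinearEquiv.ofLinearMap
    ((LinearMap.snd F V V + K ∘ₗ LinearMap.fst F V V).prod (LinearMap.fst F V V))
    ((LinearMap.snd F V V).prod (LinearMap.fst F V V - K ∘ₗ LinearMap.snd F V V))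
    (by ext <;> simp) (by ext <;> simp)
  have he : ∀ x y, e (y, x) = (x + K y, y) := fun x y => rfl
  refine (h.involution_mul hs).of_conj e fun v => ?_
  obtain ⟨y, x⟩ := v
  rw [LinearMap.prodMap_apply, Module.End.mul_apply, he, he]
  change _ = (x + K y + B y, f y)
  rw [← hK y]
  simp

end Companion

section Scalar

variable {F V : Type*} [Field F] [AddCommGroup V] [Module F V]

theorem exists_cyclic_operator [FiniteDimensional F V] (g : F[X]) (hg : g.Monic)
    (hdeg : g.natDegree = Module.finrank F V) :
    ∃ (B : Module.End F V) (w : V), (∀ v, ∃ q : F[X], aeval B q w = v) ∧ aeval B g = 0 := by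
  have : Module.Finite F (AdjoinRoot g) := (AdjoinRoot.powerBasis hg.ne_zero).finite
  have hdim : Module.finrank F (AdjoinRoot g) = Module.finrank F V := by
    rw [← hdeg]
    exact finrank_quotient_span_eq_natDegree
  let e : AdjoinRoot g ≃ₗ[F] V := LinearEquiv.ofFinrankEq _ _ hdim
  let φ : AdjoinRoot g →ₐ[F] Module.End F V :=
    (e.conjAlgEquiv F).toAlgHom.comp (Algebra.lmul F (AdjoinRoot g))
  have hφ : ∀ q : F[X], aeval (φ (AdjoinRoot.root g)) q = φ (AdjoinRoot.mk g q) := fun q => by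
    rw [aeval_algHom_apply, AdjoinRoot.aeval_eq]
  refine ⟨φ (AdjoinRoot.root g), e 1, fun v => ?_, ?_⟩
  · obtain ⟨x, rfl⟩ := e.surjective v
    obtain ⟨q, rfl⟩ := AdjoinRoot.mk_surjective x
    refine ⟨q, ?_⟩
    rw [hφ]
    simp [φ]
  · rw [hφ]
    simp

theorem prod_X_sub_C_isReciprocal {μ : F} (hμ : μ ≠ 0) {n : ℕ} (hn : 0 < n)
    (h : μ ^ n * μ ^ n = 1) :
    (∏ i ∈ Finset.range n, ((X - C (μ ^ i)⁻¹) * (X - C (μ ^ (i + 1))))).IsReciprocal := by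
  obtain ⟨m, rfl⟩ := Nat.exists_eq_add_of_lt hn
  rw [zero_add] at h ⊢
  have : ∏ i ∈ Finset.range (m + 1), ((X - C (μ ^ i)⁻¹) * (X - C (μ ^ (i + 1)))) =
      (∏ i ∈ Finset.range m, ((X - C (μ ^ (i + 1))⁻¹) * (X - C (μ ^ (i + 1))))) *
        ((X - C 1) * (X - C (μ ^ (m + 1)))) := by
    rw [Finset.prod_mul_distrib, Finset.prod_range_succ', Finset.prod_range_succ,
      Finset.prod_mul_distrib]
    simp only [pow_zero, inv_one]
    ring
  rw [this]
  refine (IsReciprocal.prod _ _ fun i _ => IsReciprocal.X_sub_C_mul (pow_ne_zero _ hμ)).mul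
    ((IsReciprocal.X_sub_C (one_mul 1)).mul (IsReciprocal.X_sub_C h))

theorem isStronglyReversible_quadraticCompanion_scalar [FiniteDimensional F V] {c : F}
    (hc0 : c ≠ 0) (hn : 0 < Module.finrank F V)
    (h : (-c) ^ Module.finrank F V * (-c) ^ Module.finrank F V = 1) :
    ∃ B : Module.End F V, IsStronglyReversible (quadraticCompanion (c • 1) B) := by
  set n := Module.finrank F V with hn_def
  set μ := -c with hμ_def
  have hμ : μ ≠ 0 := neg_ne_zero.2 hc0
  let b : ℕ → F := fun i => (μ ^ i)⁻¹ + μ ^ (i + 1)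
  let G : ℕ → F[X] := fun k => ∏ i ∈ Finset.range k, (X - C (b i))
  let P : ℕ → F[X] := fun k =>
    ∏ i ∈ Finset.range k, ((X - C (μ ^ i)⁻¹) * (X - C (μ ^ (i + 1))))
  have hG : (G n).Monic := monic_prod_of_monic _ _ fun i _ => monic_X_sub_C _
  obtain ⟨B, w, hw, hB⟩ := exists_cyclic_operator (V := V) (G n) hG (by
    rw [natDegree_prod_of_monic _ _ fun i _ => monic_X_sub_C _]; simp [hn_def])
  refine ⟨B, ?_⟩
  set N := quadraticCompanion (c • 1) B with hN_def
  let δ : Module.End F V →ₐ[F] Module.End F (V × V) :=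
    (LinearMap.prodMapAlgHom F V V).comp ((AlgHom.id F _).prod (AlgHom.id F _))
  have hδ : ∀ (T : Module.End F V) x, δ T x = (T x.1, T x.2) := fun T x => rfl
  set D := δ B with hD_def
  have haD : ∀ q : F[X], aeval D q = δ (aeval B q) := fun q => aeval_algHom_apply δ B q
  have hNN : N * N = D * N + algebraMap F _ c := by
    refine LinearMap.ext fun ⟨x, y⟩ => ?_
    simp [hN_def, hD_def, hδ, Algebra.algebraMap_eq_smul_one]
    constructor <;> abel
  have hDN : Commute D N := by
    refine LinearMap.ext fun x => ?_
    simp [hN_def, hD_def, hδ]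
  have hP : ∀ k, aeval N (P k) = aeval D (G k) * N ^ k := by
    intro k
    induction k with
    | zero => simp [P, G]
    | succ k ih =>
      have hstep : aeval N ((X - C (μ ^ k)⁻¹) * (X - C (μ ^ (k + 1)))) =
          aeval D (X - C (b k)) * N := by
        have h1 : (X - C (μ ^ k)⁻¹) * (X - C (μ ^ (k + 1))) = X * X - C (b k) * X + C μ := by
          have : μ = (μ ^ k)⁻¹ * μ ^ (k + 1) := by
            rw [pow_succ, inv_mul_cancel_left₀ (pow_ne_zero k hμ)]
          conv_rhs => rw [this]
          simp only [b, map_add, map_mul]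
          ring
        rw [h1]
        simp only [map_add, map_sub, map_mul, aeval_X, aeval_C, hNN, hμ_def, map_neg, sub_mul]
        abel
      have hcomm : Commute (N ^ k) (aeval D (X - C (b k))) := by
        simp only [map_sub, aeval_X, aeval_C]
        exact (hDN.symm.pow_left k).sub_right (Algebra.commutes _ _).symm
      change aeval N (∏ i ∈ Finset.range (k + 1), _) = aeval D (∏ i ∈ Finset.range (k + 1), _) * _
      rw [Finset.prod_range_succ, Finset.prod_range_succ, map_mul (aeval N),
        map_mul (aeval D), hstep, pow_succ]
      change aeval N (P k) * _ = aeval D (G k) * _ * _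
      rw [ih, mul_assoc, ← mul_assoc (N ^ k), hcomm.eq]
      simp only [mul_assoc]
  have hPn : aeval N (P n) = 0 := by rw [hP, haD, hB, map_zero, zero_mul]
  have hrec : (P n).IsReciprocal := prod_X_sub_C_isReciprocal hμ hn h
  set a := (P n).coeff 0 with ha_def
  have ha : a ≠ 0 := hrec.1
  have hinv : N * aeval N (P n).divX = algebraMap F _ (-a) := by
    have := hPn
    rw [← X_mul_divX_add (P n)] at this
    simp only [map_add, map_mul, aeval_X, aeval_C] at this
    rw [map_neg]
    exact eq_neg_of_add_eq_zero_left this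
  obtain ⟨d, hd⟩ : ∃ d : F[X], aeval N d = D := by
    refine ⟨X + C (c / a) * (P n).divX, ?_⟩
    have hr : N * (aeval N (C (-a⁻¹) * (P n).divX)) = 1 := by
      rw [map_mul, aeval_C, ← mul_assoc, ← Algebra.commutes, mul_assoc, hinv, ← map_mul]
      simp [ha]
    have : aeval N (X + C (c / a) * (P n).divX) * N = D * N := by
      have hQ : aeval N (P n).divX * N = algebraMap F _ (-a) := by
        rw [← hinv]
        simpa using ((Commute.all (P n).divX X).map (aeval N)).eq
      rw [map_add, add_mul, map_mul, aeval_X, aeval_C, mul_assoc, hQ, ← map_mul, hNN, add_assoc,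
        ← map_add]
      have : c + c / a * -a = 0 := by field_simp; ring
      rw [this, map_zero, add_zero]
    calc _ = aeval N (X + C (c / a) * (P n).divX) * N * (aeval N (C (-a⁻¹) * (P n).divX)) := by
            rw [mul_assoc, hr, mul_one]
      _ = D := by rw [this, mul_assoc, hr, mul_one]
  refine isStronglyReversible_of_cyclic N (w, 0) (fun x => ?_) (P n) hrec hPn ?_
  · obtain ⟨q₁, h₁⟩ := hw x.1
    obtain ⟨q₂, h₂⟩ := hw x.2
    refine ⟨q₁.comp d + q₂.comp d * X, ?_⟩
    rw [map_add, map_mul, aeval_comp, aeval_comp, hd, haD, haD, aeval_X]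
    simp [hδ, hN_def, h₁, h₂]
  · have hm : ∀ i ∈ Finset.range n, ((X - C (μ ^ i)⁻¹) * (X - C (μ ^ (i + 1)))).Monic :=
      fun i _ => (monic_X_sub_C _).mul (monic_X_sub_C _)
    rw [natDegree_prod_of_monic _ _ hm]
    simp only [(monic_X_sub_C _).natDegree_mul (monic_X_sub_C _), natDegree_X_sub_C]
    simp [hn_def, mul_two]

end Scalar

section UnipotentFactorization

variable {F V : Type*} [Field F] [AddCommGroup V] [Module F V]

theorem isNilpotent_of_exact {A B : Type*} [AddCommGroup A] [Module F A] [AddCommGroup B]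
    [Module F B] {T : Module.End F V} {P : Module.End F A} {Q : Module.End F B}
    (π : V →ₗ[F] A) (ι : B →ₗ[F] V) (hexact : LinearMap.ker π ≤ LinearMap.range ι)
    (hπ : ∀ x, π (T x) = P (π x)) (hι : ∀ b, T (ι b) = ι (Q b))
    (hP : IsNilpotent P) (hQ : IsNilpotent Q) : IsNilpotent T := by
  obtain ⟨k, hk⟩ := hP
  obtain ⟨m, hm⟩ := hQ
  have hπ' : ∀ n x, π ((T ^ n) x) = (P ^ n) (π x) := fun n => by
    induction n with
    | zero => simp
    | succ n ih => intro x; rw [pow_succ', pow_succ', Module.End.mul_apply, hπ, ih]; rfl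
  have hι' : ∀ n b, (T ^ n) (ι b) = ι ((Q ^ n) b) := fun n => by
    induction n with
    | zero => simp
    | succ n ih => intro x; rw [pow_succ', pow_succ', Module.End.mul_apply, ih, hι]; rfl
  refine ⟨m + k, LinearMap.ext fun x => ?_⟩
  rw [pow_add, Module.End.mul_apply]
  obtain ⟨b, hb⟩ := hexact (x := (T ^ k) x) (by rw [LinearMap.mem_ker, hπ', hk]; rfl)
  rw [← hb, hι', hm]
  simp

theorem IsStronglyReversible.det_mul_det {f : Module.End F V} (hf : IsStronglyReversible f) :
    LinearMap.det f * LinearMap.det f = 1 := by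
  obtain ⟨j, h₁, h₂⟩ := hf
  have d₁ := congrArg LinearMap.det h₁
  have d₂ := congrArg LinearMap.det h₂
  simp only [map_mul, map_one] at d₁ d₂
  linear_combination d₂ - LinearMap.det f * LinearMap.det f * d₁

theorem exists_dual_eq_one_eq_neg_one {v w : V} (hv : LinearIndependent F ![v, w]) :
    ∃ φ : V →ₗ[F] F, φ v = 1 ∧ φ w = -1 := by
  rw [LinearIndependent.pair_iff] at hv
  have hmem : v ∉ Submodule.span F {w + v} := by
    rw [Submodule.mem_span_singleton]
    rintro ⟨a, ha⟩
    have := hv (a - 1) a (by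
      rw [← sub_eq_zero] at ha
      rw [← ha, smul_add, sub_smul, one_smul]
      abel)
    rw [this.2] at this
    simp at this
  obtain ⟨α, hα, hα'⟩ := Submodule.exists_le_ker_of_notMem hmem
  have hα' : α (w + v) = 0 := hα' (Submodule.mem_span_singleton_self _)
  refine ⟨(α v)⁻¹ • α, by simp [hα], ?_⟩
  rw [map_add, add_eq_zero_iff_eq_neg] at hα'
  simp [hα', hα]

theorem exists_dual_separating [FiniteDimensional F V] {f : Module.End F V}
    (hf : Function.Injective f) {v : V} (hv : LinearIndependent F ![v, f v])
    (hdim : 3 ≤ Module.finrank F V) :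
    ∃ φ : V →ₗ[F] F, φ v = 1 ∧ φ (f v) = -1 ∧
      ∀ c : F, ∃ w, φ w = 0 ∧ ∀ t : F, f w - c • w ≠ t • f v := by
  obtain ⟨φ, hφv, hφf⟩ := exists_dual_eq_one_eq_neg_one hv
  rw [LinearIndependent.pair_iff] at hv
  obtain ⟨ψ, hψ0, hψ⟩ : ∃ ψ : V →ₗ[F] F, ψ ≠ 0 ∧ Submodule.span F {v, f v} ≤ LinearMap.ker ψ := by
    apply Submodule.exists_le_ker_of_lt_top
    rw [lt_top_iff_ne_top]
    intro h
    have h1 : Module.finrank F (Submodule.span F ({v, f v} : Set V)) ≤ 2 := by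
      classical
      have := finrank_span_finset_le_card (R := F) ({v, f v} : Finset V)
      rw [Finset.coe_pair] at this
      exact this.trans Finset.card_le_two
    rw [h, finrank_top] at h1
    omega
  have hψv : ψ v = 0 := hψ (Submodule.subset_span (by simp))
  have hψf : ψ (f v) = 0 := hψ (Submodule.subset_span (by simp))
  by_contra! hcon
  obtain ⟨c, hc⟩ := hcon φ hφv hφf
  obtain ⟨c', hc'⟩ := hcon (φ + ψ) (by simp [hφv, hψv]) (by simp [hφf, hψf])
  obtain ⟨x, hx⟩ : ∃ x, ψ x ≠ 0 := by
    by_contra! h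
    exact hψ0 (LinearMap.ext h)
  set w := x - φ x • v with hw
  have hφw : φ w = 0 := by simp [hw, hφv]
  have hψw : ψ w ≠ 0 := by simpa [hw, hψv] using hx
  obtain ⟨t, ht⟩ := hc w hφw
  have hcc : c = c' := by
    obtain ⟨t₁, h₁⟩ := hc (f v + v) (by simp [hφv, hφf])
    obtain ⟨t₂, h₂⟩ := hc' (f v + v) (by simp [hφv, hφf, hψv, hψf])
    have := hv (c' - c) (c' - c - t₁ + t₂) (by
      have : (c' - c) • (f v + v) = t₁ • f v - t₂ • f v := by
        rw [← h₁, ← h₂, sub_smul]; abel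
      rw [smul_add] at this
      rw [add_smul, sub_smul (c' - c) t₁, ← sub_eq_zero.2 this]
      abel)
    exact (sub_eq_zero.1 this.1).symm
  subst hcc
  obtain ⟨t', ht'⟩ := hc' (w - ψ w • v) (by simp [hφv, hψv, hφw])
  have hzero := hv (c * ψ w) (t - t' - ψ w) (by
    have : f w - c • w - t • f v = 0 := sub_eq_zero.2 ht
    have h' : f (w - ψ w • v) - c • (w - ψ w • v) - t' • f v = 0 := sub_eq_zero.2 ht'
    rw [map_sub, map_smul, smul_sub, ← mul_smul] at h'
    linear_combination (norm := module) h' - this)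
  have hc0 : c = 0 := by simpa [hψw] using hzero.1
  rw [hc0, zero_smul, sub_zero, ← map_smul] at ht
  have hwv := hf ht
  rw [hwv, map_smul, hψv, smul_zero] at hψw
  exact hψw rfl

/-- `f` is a product of two operators, each with all its eigenvalues in `{1, -1}`. -/
def HasQuasiUnipotentFactorization (f : Module.End F V) : Prop :=
  ∃ L U : Module.End F V, f = L * U ∧ IsNilpotent (L ^ 2 - 1) ∧ IsNilpotent (U ^ 2 - 1)

section Schur

variable (f : Module.End F V) (v : V) (φ : V →ₗ[F] F) (hφv : φ v = 1)

/-- The projection onto `ker φ` along `v`. -/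
def projKer : V →ₗ[F] LinearMap.ker φ :=
  (LinearMap.id - φ.smulRight v).codRestrict _ fun x => by simp [hφv]

@[simp]
theorem coe_projKer (x : V) : (projKer v φ hφv x : V) = x - φ x • v := rfl

theorem projKer_coe (w : LinearMap.ker φ) : projKer v φ hφv w = w := by
  ext
  simp

theorem projKer_self : projKer v φ hφv v = 0 := by
  ext
  simp [hφv]

variable (hφf : φ (f v) = -1)

/-- The Schur complement of `f` with respect to the splitting `V = F v ⊕ ker φ`. -/
def schurKer : Module.End F (LinearMap.ker φ) :=
  ((f + (φ ∘ₗ f).smulRight (f v)) ∘ₗ (LinearMap.ker φ).subtype).codRestrict _ fun x => by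
    simp [hφf]

@[simp]
theorem coe_schurKer (x : LinearMap.ker φ) :
    (schurKer f v φ hφf x : V) = f x + φ (f x) • f v := rfl

/-- The lower triangular factor built from an operator on `ker φ`. -/
def lowerFactor (L : Module.End F (LinearMap.ker φ)) : Module.End F V :=
  (LinearMap.ker φ).subtype ∘ₗ L ∘ₗ projKer v φ hφv - φ.smulRight (f v)

/-- The upper triangular factor built from an operator on `ker φ`. -/
def upperFactor (U : Module.End F (LinearMap.ker φ)) : Module.End F V :=
  (LinearMap.ker φ).subtype ∘ₗ U ∘ₗ projKer v φ hφv + (φ ∘ₗ f).smulRight v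

theorem lowerFactor_apply (L : Module.End F (LinearMap.ker φ)) (x : V) :
    lowerFactor f v φ hφv L x = L (projKer v φ hφv x) - φ x • f v := rfl

theorem upperFactor_apply (U : Module.End F (LinearMap.ker φ)) (x : V) :
    upperFactor f v φ hφv U x = U (projKer v φ hφv x) + φ (f x) • v := rfl

theorem projKer_upperFactor (U : Module.End F (LinearMap.ker φ)) (x : V) :
    projKer v φ hφv (upperFactor f v φ hφv U x) = U (projKer v φ hφv x) := by
  rw [upperFactor_apply, map_add, map_smul, projKer_coe, projKer_self, smul_zero, add_zero]

theorem lowerFactor_mul_upperFactor {L U : Module.End F (LinearMap.ker φ)}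
    (h : schurKer f v φ hφf = L * U) :
    f = lowerFactor f v φ hφv L * upperFactor f v φ hφv U := by
  ext x
  have h1 : φ (upperFactor f v φ hφv U x) = φ (f x) := by simp [upperFactor_apply, hφv]
  rw [Module.End.mul_apply, lowerFactor_apply, projKer_upperFactor, ← Module.End.mul_apply, ← h,
    h1, coe_schurKer, coe_projKer]
  simp only [map_sub, map_smul, hφf, smul_eq_mul, mul_neg, mul_one, sub_neg_eq_add, add_smul]
  abel

theorem isNilpotent_lowerFactor (hφf : φ (f v) = -1)
    {L : Module.End F (LinearMap.ker φ)}
    (hL : IsNilpotent (L ^ 2 - 1)) : IsNilpotent (lowerFactor f v φ hφv L ^ 2 - 1) := by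
  have h1 : ∀ x, φ (lowerFactor f v φ hφv L x) = φ x := fun x => by
    simp [lowerFactor_apply, hφf]
  have h2 : ∀ w : LinearMap.ker φ, lowerFactor f v φ hφv L w = L w := fun w => by
    rw [lowerFactor_apply, projKer_coe, LinearMap.mem_ker.1 w.2, zero_smul, sub_zero]
  refine isNilpotent_of_exact (P := (0 : Module.End F F)) φ (LinearMap.ker φ).subtype
    (by simp) (fun x => ?_) (fun w => ?_) IsNilpotent.zero hL
  · simp [pow_two, h1]
  · simp [pow_two, h2]

theorem isNilpotent_upperFactor (hφf : φ (f v) = -1)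
    {U : Module.End F (LinearMap.ker φ)}
    (hU : IsNilpotent (U ^ 2 - 1)) : IsNilpotent (upperFactor f v φ hφv U ^ 2 - 1) := by
  have h2 : upperFactor f v φ hφv U v = -v := by
    rw [upperFactor_apply, projKer_self, hφf]
    simp
  refine isNilpotent_of_exact (Q := (0 : Module.End F F)) (projKer v φ hφv)
    (LinearMap.toSpanSingleton F V v) (fun x hx => ⟨φ x, ?_⟩) (fun x => ?_) (fun a => ?_)
    hU IsNilpotent.zero
  · have := congrArg Subtype.val (LinearMap.mem_ker.1 hx)
    rw [coe_projKer] at this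
    exact (sub_eq_zero.1 this).symm
  · simp [pow_two, projKer_upperFactor, -coe_projKer]
  · simp [pow_two, h2]

theorem det_schurKer [FiniteDimensional F V] (hφv : φ v = 1) :
    LinearMap.det f * LinearMap.det f =
      LinearMap.det (schurKer f v φ hφf) * LinearMap.det (schurKer f v φ hφf) := by
  set g := schurKer f v φ hφf with hg
  let R := upperFactor f v φ hφv 1
  let e : V ≃ₗ[F] F × LinearMap.ker φ := LinearEquiv.ofLinearMap
    (φ.prod (projKer v φ hφv))
    ((LinearMap.toSpanSingleton F V v).coprod (LinearMap.ker φ).subtype)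
    (by ext <;> simp [hφv]) (by ext; simp)
  let D : Module.End F V := e.symm.conj ((1 : Module.End F F).prodMap g)
  have hD : ∀ x, D x = φ x • v + g (projKer v φ hφv x) := fun x => rfl
  have hfac : upperFactor f v φ hφv g = D * R := by
    ext x
    rw [Module.End.mul_apply, hD, projKer_upperFactor, upperFactor_apply, upperFactor_apply]
    simp [hφv, add_comm]
  have hf := lowerFactor_mul_upperFactor f v φ hφv hφf (one_mul g).symm
  have nil : IsNilpotent ((1 : Module.End F (LinearMap.ker φ)) ^ 2 - 1) := by simp
  have dL := (isStronglyReversible_of_isNilpotent _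
    (isNilpotent_lowerFactor f v φ hφv hφf nil)).det_mul_det
  have dR := (isStronglyReversible_of_isNilpotent _
    (isNilpotent_upperFactor f v φ hφv hφf nil)).det_mul_det
  have dD : LinearMap.det D = LinearMap.det g :=
    (LinearMap.det_conj ((1 : Module.End F F).prodMap g) e.symm).trans
      (by rw [LinearMap.det_prodMap, map_one, one_mul])
  rw [hfac] at hf
  have := congrArg LinearMap.det hf
  rw [map_mul, map_mul, dD] at this
  rw [this]
  linear_combination (LinearMap.det g * LinearMap.det R) ^ 2 * dL + LinearMap.det g ^ 2 * dR

end Schur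

theorem hasQuasiUnipotentFactorization_of_finrank (n : ℕ) :
    ∀ {V : Type*} [AddCommGroup V] [Module F V] [FiniteDimensional F V] (f : Module.End F V),
      Module.finrank F V = n + 1 → LinearMap.det f * LinearMap.det f = 1 →
      (n ≠ 0 → ∃ v, LinearIndependent F ![v, f v]) → HasQuasiUnipotentFactorization f := by
  induction n with
  | zero =>
    intro V _ _ _ f hn hdet _
    obtain ⟨c, rfl⟩ := LinearMap.exists_eq_smul_id_of_forall_notLinearIndependent (f := f)
      fun v hv => by
        have := hv.fintype_card_le_finrank
        simp [hn] at this
    refine ⟨1, c • 1, (one_mul _).symm, by simp, ?_⟩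
    have hc : c * c = 1 := by
      rw [LinearMap.det_smul] at hdet
      simpa [hn] using hdet
    rw [pow_two, smul_mul_smul_comm, hc]
    simp
  | succ n ih =>
    intro V _ _ _ f hn hdet hv
    obtain ⟨v, hv⟩ := hv (Nat.succ_ne_zero n)
    have hinj : Function.Injective f := by
      have hu : IsUnit (LinearMap.det f) := IsUnit.of_mul_eq_one _ hdet
      exact ((Module.End.isUnit_iff f).1 ((LinearMap.isUnit_iff_isUnit_det f).2 hu)).1
    obtain ⟨φ, hφv, hφf, hφ⟩ : ∃ φ : V →ₗ[F] F, φ v = 1 ∧ φ (f v) = -1 ∧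
        (n ≠ 0 → ∀ c : F, ∃ w, φ w = 0 ∧ ∀ t : F, f w - c • w ≠ t • f v) := by
      rcases eq_or_ne n 0 with h0 | h0
      · obtain ⟨φ, h₁, h₂⟩ := exists_dual_eq_one_eq_neg_one hv
        exact ⟨φ, h₁, h₂, fun h => absurd h0 h⟩
      · obtain ⟨φ, h₁, h₂, h₃⟩ := exists_dual_separating hinj hv (by omega)
        exact ⟨φ, h₁, h₂, fun _ => h₃⟩
    have hker : Module.finrank F (LinearMap.ker φ) = n + 1 := by
      have h1 := φ.finrank_range_add_finrank_ker
      have h2 : LinearMap.range φ = ⊤ := LinearMap.range_eq_top.2 fun a => ⟨a • v, by simp [hφv]⟩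
      rw [h2, finrank_top, Module.finrank_self, hn] at h1
      omega
    obtain ⟨L, U, hLU, hL, hU⟩ := ih (schurKer f v φ hφf) hker
      (by rw [← det_schurKer f v φ hφf hφv, hdet]) fun hn0 => by
        by_contra! hcon
        obtain ⟨c, hc⟩ := LinearMap.exists_eq_smul_id_of_forall_notLinearIndependent hcon
        obtain ⟨w, hw, hwt⟩ := hφ hn0 c
        apply hwt (-φ (f w))
        have := congrArg Subtype.val (LinearMap.congr_fun hc ⟨w, hw⟩)
        rw [coe_schurKer] at this
        simp only [LinearMap.smul_apply, Module.End.one_apply, Submodule.coe_smul] at this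
        rw [← this]
        simp
    exact ⟨_, _, lowerFactor_mul_upperFactor f v φ hφv hφf hLU,
      isNilpotent_lowerFactor f v φ hφv hφf hL, isNilpotent_upperFactor f v φ hφv hφf hU⟩

end UnipotentFactorization

section StableLength

variable {F V : Type*} [Field F] [AddCommGroup V] [Module F V]

theorem IsProdThreeInvolutions.prodMap_one_of_isCompl {f : Module.End F V} {K R : Submodule F V}
    (hKR : IsCompl K R) (hK : ∀ x ∈ K, f x ∈ K) (hR : ∀ x ∈ R, f x ∈ R)
    (hfK : IsProdThreeInvolutions ((f.restrict hK).prodMap (1 : Module.End F K)))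
    (hfR : IsProdThreeInvolutions ((f.restrict hR).prodMap (1 : Module.End F R))) :
    IsProdThreeInvolutions (f.prodMap (1 : Module.End F V)) := by
  let d := K.prodEquivOfIsCompl R hKR
  refine (hfK.prodMap hfR).of_conj
    ((d.symm.prodCongr d.symm).trans (LinearEquiv.prodProdProdComm F K R K R)) fun v => ?_
  obtain ⟨x, y⟩ := v
  obtain ⟨x, rfl⟩ := d.surjective x
  obtain ⟨y, rfl⟩ := d.surjective y
  have hd : f (d x) = d (f.restrict hK x.1, f.restrict hR x.2) := by
    simp [d]
  simp [hd]

variable [FiniteDimensional F V]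

theorem HasQuasiUnipotentFactorization.exists_isStronglyReversible {f : Module.End F V}
    (hf : HasQuasiUnipotentFactorization f) :
    ∃ B : Module.End F V, IsStronglyReversible (quadraticCompanion f B) := by
  obtain ⟨L, U, rfl, hL, hU⟩ := hf
  refine ⟨L - U, ?_⟩
  let N : Module.End F (V × V) :=
    (L ∘ₗ LinearMap.fst F V V).prod (LinearMap.fst F V V - U ∘ₗ LinearMap.snd F V V)
  have hN : IsNilpotent (N ^ 2 - 1) :=
    isNilpotent_of_exact (LinearMap.fst F V V) (LinearMap.inr F V V)
      (fun x hx => ⟨x.2, Prod.ext (LinearMap.mem_ker.1 hx).symm rfl⟩)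
      (fun x => by simp [N, pow_two]) (fun b => by simp [N, pow_two]) hL hU
  let e : (V × V) ≃ₗ[F] V × V := LinearEquiv.ofLinearMap
    ((LinearMap.fst F V V + L ∘ₗ LinearMap.snd F V V).prod (LinearMap.snd F V V))
    ((LinearMap.fst F V V - L ∘ₗ LinearMap.snd F V V).prod (LinearMap.snd F V V))
    (by ext <;> simp) (by ext <;> simp)
  have he : ∀ x, e x = (x.1 + L x.2, x.2) := fun x => rfl
  refine (isStronglyReversible_of_isNilpotent N hN).of_conj e fun v => ?_
  rw [he, he, quadraticCompanion_apply]
  ext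
  · simp [N]
    abel
  · simp [N]
    abel

theorem exists_isStronglyReversible_quadraticCompanion {f : Module.End F V}
    (hn : 0 < Module.finrank F V) (hdet : LinearMap.det f * LinearMap.det f = 1) :
    ∃ B : Module.End F V, IsStronglyReversible (quadraticCompanion f B) := by
  by_cases h : ∃ v, LinearIndependent F ![v, f v]
  · exact (hasQuasiUnipotentFactorization_of_finrank (Module.finrank F V - 1) f (by omega) hdet
      fun _ => h).exists_isStronglyReversible
  · obtain ⟨c, rfl⟩ := LinearMap.exists_eq_smul_id_of_forall_notLinearIndependent (f := f)
      (by simpa using h)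
    have hc : c ^ Module.finrank F V * c ^ Module.finrank F V = 1 := by
      simpa [LinearMap.det_smul] using hdet
    refine isStronglyReversible_quadraticCompanion_scalar ?_ hn ?_
    · rintro rfl
      simp [hn.ne'] at hc
    · rw [← mul_pow, neg_mul_neg, mul_pow, hc]

theorem isProdThreeInvolutions_prodMap_one_of_isUnit {f : Module.End F V}
    (hf : IsUnit (f - 1)) (hdet : LinearMap.det f * LinearMap.det f = 1) :
    IsProdThreeInvolutions (f.prodMap (1 : Module.End F V)) := by
  rcases (Module.finrank F V).eq_zero_or_pos with h | h
  · have := Module.finrank_zero_iff.1 h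
    exact ⟨1, 1, 1, one_mul _, one_mul _, one_mul _, Subsingleton.elim _ _⟩
  · obtain ⟨B, hB⟩ := exists_isStronglyReversible_quadraticCompanion h hdet
    exact isProdThreeInvolutions_prodMap_of_quadraticCompanion hf hB

theorem isProdThreeInvolutions_prodMap_one {f : Module.End F V}
    (hdet : LinearMap.det f * LinearMap.det f = 1) :
    IsProdThreeInvolutions (f.prodMap (1 : Module.End F V)) := by
  obtain ⟨k, hKR, hk⟩ := ((LinearMap.eventually_isCompl_ker_pow_range_pow (f - 1)).and
    (Filter.eventually_ge_atTop 1)).exists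
  set K := LinearMap.ker ((f - 1) ^ k) with hK_def
  set R := LinearMap.range ((f - 1) ^ k) with hR_def
  have hcomm : Commute ((f - 1) ^ k) f :=
    ((Commute.refl f).sub_left (Commute.one_left f)).pow_left k
  have hcomm' : ∀ x, ((f - 1) ^ k) (f x) = f (((f - 1) ^ k) x) := LinearMap.congr_fun hcomm.eq
  have hK : ∀ x ∈ K, f x ∈ K := fun x hx => by
    rw [hK_def, LinearMap.mem_ker, hcomm', LinearMap.mem_ker.1 hx, map_zero]
  have hR : ∀ x ∈ R, f x ∈ R := by
    rintro _ ⟨x, rfl⟩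
    exact ⟨f x, hcomm' x⟩
  have hdet_eq : LinearMap.det f =
      LinearMap.det (f.restrict hK) * LinearMap.det (f.restrict hR) := by
    have : f = (K.prodEquivOfIsCompl R hKR).conj ((f.restrict hK).prodMap (f.restrict hR)) := by
      ext x
      obtain ⟨x, rfl⟩ := (K.prodEquivOfIsCompl R hKR).surjective x
      rw [LinearEquiv.conj_apply_apply, LinearEquiv.symm_apply_apply]
      simp
    conv_lhs => rw [this]
    exact (LinearMap.det_conj ((f.restrict hK).prodMap (f.restrict hR))
      (K.prodEquivOfIsCompl R hKR)).trans (LinearMap.det_prodMap _ _)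
  have hnil : IsNilpotent (f.restrict hK ^ 2 - 1) := by
    have h1 : IsNilpotent (f.restrict hK - 1) := by
      refine ⟨k, LinearMap.ext fun x => Subtype.ext ?_⟩
      have : ∀ m : ℕ, (((f.restrict hK - 1) ^ m) x : V) = ((f - 1) ^ m) x := fun m => by
        induction m with
        | zero => simp
        | succ m ih =>
          rw [pow_succ', pow_succ', Module.End.mul_apply, Module.End.mul_apply, ← ih]
          rfl
      rw [this]
      exact x.2
    have h2 := Commute.sq_sub_sq (Commute.one_right (f.restrict hK))
    rw [one_pow] at h2
    rw [h2]
    refine Commute.isNilpotent_mul_left ?_ h1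
    exact ((Commute.refl _).add_left (Commute.one_left _)).sub_right (Commute.one_right _)
  have hrev := isStronglyReversible_of_isNilpotent _ hnil
  refine .prodMap_one_of_isCompl hKR hK hR ?_ (isProdThreeInvolutions_prodMap_one_of_isUnit ?_ ?_)
  · exact hrev.isProdThreeInvolutions.prodMap ⟨1, 1, 1, one_mul _, one_mul _, one_mul _, rfl⟩
  · rw [Module.End.isUnit_iff]
    refine (LinearMap.injective_iff_surjective.1 ?_ |> fun h => ⟨?_, h⟩) <;>
    · rw [injective_iff_map_eq_zero]
      intro x hx
      have hx' : (f - 1) (x : V) = 0 := congrArg Subtype.val hx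
      have hxK : (x : V) ∈ K := by
        obtain ⟨m, rfl⟩ := Nat.exists_eq_add_of_le' hk
        rw [hK_def, LinearMap.mem_ker, pow_succ, Module.End.mul_apply, hx', map_zero]
      exact Subtype.ext ((Submodule.disjoint_def.1 hKR.disjoint) x hxK x.2)
  · have := hrev.det_mul_det
    rw [hdet_eq] at hdet
    linear_combination hdet - LinearMap.det (f.restrict hR) ^ 2 * this

end StableLength

end

/-- **Stable length-3 problem, three involutions.**
Let `F` be a field, `n` a positive integer, and `A ∈ GLₙ(F)` with `det A = ±1`.
Then the augmented matrix `A ⊕ Iₙ ∈ GL₂ₙ(F)` is a product of three involutions. -/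
theorem stmt0 {F : Type*} [Field F] {n : ℕ} (hn : 0 < n)
    (A : Matrix (Fin n) (Fin n) F) (hA : IsUnit A)
    (hdet : A.det = 1 ∨ A.det = -1) :
    ∃ S₁ S₂ S₃ : Matrix (Fin (n + n)) (Fin (n + n)) F,
      S₁ * S₁ = 1 ∧ S₂ * S₂ = 1 ∧ S₃ * S₃ = 1 ∧
      Matrix.reindex finSumFinEquiv finSumFinEquiv
        (Matrix.fromBlocks A 0 0 (1 : Matrix (Fin n) (Fin n) F)) = S₁ * S₂ * S₃ := by
  have h := isProdThreeInvolutions_prodMap_one (f := Matrix.toLin' A)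
    (by rw [LinearMap.det_toLin']; rcases hdet with h | h <;> simp [h])
  let b := Pi.basisFun F (Fin n)
  let ψ : Module.End F ((Fin n → F) × (Fin n → F)) ≃ₐ[F] Matrix (Fin (n + n)) (Fin (n + n)) F :=
    (LinearMap.toMatrixAlgEquiv (b.prod b)).trans
    (Matrix.reindexAlgEquiv F F (finSumFinEquiv (m := n) (n := n)))
  have hψ : ψ ((Matrix.toLin' A).prodMap 1) = Matrix.reindex finSumFinEquiv finSumFinEquiv
      (Matrix.fromBlocks A 0 0 (1 : Matrix (Fin n) (Fin n) F)) := by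
    refine congrArg (Matrix.reindex finSumFinEquiv finSumFinEquiv)
      ((LinearMap.toMatrix_prodMap b b (Matrix.toLin' A) 1).trans ?_)
    rw [LinearMap.toMatrix_one, ← Matrix.toLin_eq_toLin', LinearMap.toMatrix_toLin]
  obtain ⟨S₁, S₂, S₃, h₁, h₂, h₃, h⟩ :=
    h.map (ψ : Module.End F _ →* Matrix (Fin (n + n)) (Fin (n + n)) F)
  exact ⟨S₁, S₂, S₃, h₁, h₂, h₃, hψ.symm.trans h⟩
end

section
/- Let F be a field, let n be a positive integer, and let A ∈ GL_n(F) have determinant 1. Then the augmented matrix A ⊕ I_n ∈ GL_{2n}(F) can be written as a product of three unipotent matrices of index 2 (U2-matrices) of GL_{2n}(F). -/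
/-- `u` is unipotent of index at most 2. -/
def IsU2 {R : Type*} [Ring R] (u : R) : Prop := (u - 1) * (u - 1) = 0

/-- `x` is a product of two unipotents of index at most 2. -/
def IsProdTwoU2 {R : Type*} [Ring R] (x : R) : Prop := ∃ u v : R, IsU2 u ∧ IsU2 v ∧ x = u * v

/-- `x` is a product of three unipotents of index at most 2. -/
def IsProdThreeU2 {R : Type*} [Ring R] (x : R) : Prop :=
  ∃ u v w : R, IsU2 u ∧ IsU2 v ∧ IsU2 w ∧ x = u * v * w

section Ring

variable {R S : Type*} [Ring R] [Ring S]

theorem isU2_one : IsU2 (1 : R) := by simp [IsU2]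

theorem IsU2.map (f : R →+* S) {u : R} (hu : IsU2 u) : IsU2 (f u) := by
  have := congrArg f hu
  simpa [IsU2] using this

theorem IsProdTwoU2.map (f : R →+* S) {x : R} : IsProdTwoU2 x → IsProdTwoU2 (f x) := by
  rintro ⟨u, v, hu, hv, rfl⟩
  exact ⟨f u, f v, hu.map f, hv.map f, by simp⟩

theorem IsProdThreeU2.map (f : R →+* S) {x : R} : IsProdThreeU2 x → IsProdThreeU2 (f x) := by
  rintro ⟨u, v, w, hu, hv, hw, rfl⟩
  exact ⟨f u, f v, f w, hu.map f, hv.map f, hw.map f, by simp⟩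

theorem isProdTwoU2_map_iff (e : R ≃+* S) {x : R} : IsProdTwoU2 (e x) ↔ IsProdTwoU2 x :=
  ⟨fun h ↦ by simpa using h.map (e.symm : S →+* R), fun h ↦ h.map (e : R →+* S)⟩

theorem isProdThreeU2_map_iff (e : R ≃+* S) {x : R} : IsProdThreeU2 (e x) ↔ IsProdThreeU2 x :=
  ⟨fun h ↦ by simpa using h.map (e.symm : S →+* R), fun h ↦ h.map (e : R →+* S)⟩

theorem IsU2.conj {u p q : R} (hqp : q * p = 1) (hpq : p * q = 1) (hu : IsU2 u) :
    IsU2 (p * u * q) := by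
  have h : p * u * q - 1 = p * (u - 1) * q := by simp [mul_sub, sub_mul, hpq]
  have h' : p * (u - 1) * q * (p * (u - 1) * q) = p * ((u - 1) * ((q * p) * (u - 1))) * q := by
    simp only [mul_assoc]
  rw [IsU2] at hu
  rw [IsU2, h, h', hqp, one_mul, hu, mul_zero, zero_mul]

theorem IsProdTwoU2.conj {x p q : R} (hqp : q * p = 1) (hpq : p * q = 1) :
    IsProdTwoU2 x → IsProdTwoU2 (p * x * q) := by
  rintro ⟨u, v, hu, hv, rfl⟩
  refine ⟨_, _, hu.conj hqp hpq, hv.conj hqp hpq, ?_⟩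
  calc p * (u * v) * q = p * u * 1 * v * q := by simp only [mul_assoc, one_mul]
    _ = _ := by rw [← hqp]; simp only [mul_assoc]

theorem IsProdThreeU2.conj {x p q : R} (hqp : q * p = 1) (hpq : p * q = 1) :
    IsProdThreeU2 x → IsProdThreeU2 (p * x * q) := by
  rintro ⟨u, v, w, hu, hv, hw, rfl⟩
  refine ⟨_, _, _, hu.conj hqp hpq, hv.conj hqp hpq, hw.conj hqp hpq, ?_⟩
  calc p * (u * v * w) * q = p * u * 1 * v * 1 * w * q := by simp only [mul_assoc, one_mul]
    _ = _ := by rw [← hqp]; simp only [mul_assoc]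

theorem IsProdTwoU2.mul {x w : R} (hw : IsU2 w) : IsProdTwoU2 x → IsProdThreeU2 (x * w) := by
  rintro ⟨u, v, hu, hv, rfl⟩
  exact ⟨u, v, w, hu, hv, hw, rfl⟩

end Ring

theorem exists_disjoint_sup_inf_eq {α : Type*} [Lattice α] [BoundedOrder α] [IsModularLattice α]
    [ComplementedLattice α] {a b c : α} (hab : a ≤ b) (hac : Disjoint a c) :
    ∃ x, a ≤ x ∧ x ≤ b ∧ Disjoint x c ∧ x ⊔ b ⊓ c = b := by
  obtain ⟨z, hz, hzb⟩ := IsModularLattice.exists_disjoint_and_sup_eq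
    (sup_le hab inf_le_left : a ⊔ b ⊓ c ≤ b)
  have hzle : z ≤ b := hzb ▸ le_sup_right
  refine ⟨a ⊔ z, le_sup_left, sup_le hab hzle, ?_, ?_⟩
  · have h : Disjoint (a ⊔ z) (b ⊓ c) := by
      have h1 : Disjoint a (b ⊓ c) := hac.mono_right inf_le_right
      have := h1.symm.disjoint_sup_right_of_disjoint_sup_left (c := z) (by rwa [sup_comm])
      exact this.symm
    rw [disjoint_iff] at h ⊢
    rw [← h, ← inf_assoc, inf_eq_left.2 (sup_le hab hzle)]
  · exact (sup_right_comm a z (b ⊓ c)).trans hzb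

theorem LinearMap.exists_isCompl_map_le {K V : Type*} [Field K] [AddCommGroup V] [Module K V]
    {N g : Module.End K V} (hN : IsNilpotent N) (hg : g * (1 + N) = 1) :
    ∃ P Q : Submodule K V, IsCompl P Q ∧ (∀ x ∈ Q, N x ∈ P) ∧ ∀ x ∈ P, g (N x) ∈ Q := by
  obtain ⟨k, hk⟩ := hN
  have key : ∀ i j, i + j = k → ∃ P Q : Submodule K V, Disjoint P Q ∧
      P ⊔ Q = LinearMap.range (N ^ j) ∧ (∀ x ∈ Q, N x ∈ P) ∧ ∀ x ∈ P, g (N x) ∈ Q := by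
    intro i
    induction i with
    | zero =>
      intro j hj
      obtain rfl : j = k := by omega
      exact ⟨⊥, ⊥, disjoint_bot_left, by simp [hk], by simp, by simp⟩
    | succ i ih =>
      intro j hj
      obtain ⟨P, Q, hd, hs, hQP, hPQ⟩ := ih (j + 1) (by omega)
      set W := LinearMap.range (N ^ j) with hW
      have hWN : ∀ x ∈ W, N x ∈ W := by
        rintro _ ⟨y, rfl⟩
        exact ⟨N y, by rw [← Module.End.mul_apply, ← Module.End.mul_apply, ← pow_succ, pow_succ']⟩
      have hlift : ∀ x ∈ P ⊔ Q, ∃ y ∈ W, N y = x := by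
        rw [hs]
        rintro _ ⟨y, rfl⟩
        exact ⟨(N ^ j) y, ⟨y, rfl⟩, by rw [← Module.End.mul_apply, ← pow_succ']⟩
      have hle : P ⊔ Q ≤ W := by
        intro x hx
        obtain ⟨y, hy, rfl⟩ := hlift x hx
        exact hWN y hy
      let P' : Submodule K V := W ⊓ Q.comap (g * N)
      let Q' : Submodule K V := W ⊓ P.comap N
      have hP : P ≤ P' := le_inf (le_sup_left.trans hle) hPQ
      have hQ : Q ≤ Q' := le_inf (le_sup_right.trans hle) hQP
      have hsup : W ≤ P' ⊔ Q' := by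
        intro w hw
        have hNw : N w ∈ P ⊔ Q := by
          rw [hs]
          obtain ⟨y, rfl⟩ := hw
          exact ⟨y, by rw [← Module.End.mul_apply, ← pow_succ']⟩
        obtain ⟨a, ha, c, hc, hac⟩ := Submodule.mem_sup.1 hNw
        obtain ⟨u, hu, hua⟩ := hlift (a - N c)
          (Submodule.mem_sup_left (P.sub_mem ha (hQP c hc)))
        obtain ⟨y, hy, hyc⟩ := hlift c (Submodule.mem_sup_right hc)
        have huQ : u ∈ Q' := ⟨hu, by simpa [hua] using P.sub_mem ha (hQP c hc)⟩
        have hgc : g (c + N c) = c := by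
          simpa using LinearMap.congr_fun hg c
        have hNwu : N (w - u) = c + N c := by
          rw [map_sub, hua, ← hac]; abel
        have hwP : w - u ∈ P' := ⟨W.sub_mem hw hu, by
          simpa [hNwu, hgc, -map_sub, -map_add] using hc⟩
        exact Submodule.mem_sup.2 ⟨w - u, hwP, u, huQ, by abel⟩
      obtain ⟨Q₁, hQQ₁, hQ₁Q', hQ₁d, hQ₁s⟩ := exists_disjoint_sup_inf_eq hQ hd.symm
      obtain ⟨P₁, hPP₁, hP₁P', hP₁d, hP₁s⟩ := exists_disjoint_sup_inf_eq hP hQ₁d.symm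
      refine ⟨P₁, Q₁, hP₁d, le_antisymm ?_ ?_, ?_, ?_⟩
      · exact sup_le (hP₁P'.trans inf_le_left) (hQ₁Q'.trans inf_le_left)
      · refine hsup.trans (sup_le ?_ ?_)
        · rw [← hP₁s]
          exact sup_le_sup_left inf_le_right _
        · rw [← hQ₁s]
          exact sup_le le_sup_right ((inf_le_right.trans hPP₁).trans le_sup_left)
      · exact fun x hx ↦ hPP₁ (hQ₁Q' hx).2
      · exact fun x hx ↦ hQQ₁ (hP₁P' hx).2
  obtain ⟨P, Q, hd, hs, hQP, hPQ⟩ := key k 0 rfl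
  exact ⟨P, Q, ⟨hd, codisjoint_iff.2 (by simpa [Module.End.one_eq_id] using hs)⟩, hQP, hPQ⟩

theorem isProdTwoU2_of_isNilpotent {K V : Type*} [Field K] [AddCommGroup V] [Module K V]
    {u : Module.End K V} (hu : IsNilpotent (u - 1)) : IsProdTwoU2 u := by
  obtain ⟨N, rfl⟩ : ∃ N, u = 1 + N := ⟨u - 1, by abel⟩
  rw [add_sub_cancel_left] at hu
  obtain ⟨U, hU⟩ := hu.isUnit_one_add
  have hg : (↑U⁻¹ : Module.End K V) * (1 + N) = 1 := by rw [← hU]; simp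
  have hg' : (1 + N) * (↑U⁻¹ : Module.End K V) = 1 := by rw [← hU]; simp
  set g : Module.End K V := ↑U⁻¹
  obtain ⟨P, Q, hPQ, hQ, hP⟩ := LinearMap.exists_isCompl_map_le hu hg
  have hgN : ∀ x, g (N x) + N (g (N x)) = N x := fun x ↦ by
    simpa using LinearMap.congr_fun hg' (N x)
  let p := P.projection Q hPQ
  let q := Q.projection P hPQ.symm
  have hpq : ∀ x, p x + q x = x := fun x ↦ by
    simpa using Submodule.projection_add_projection_eq_self hPQ x
  have hpP : ∀ x, p x ∈ P := Submodule.projection_apply_mem hPQ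
  have hqQ : ∀ x, q x ∈ Q := Submodule.projection_apply_mem hPQ.symm
  have hqP : ∀ x ∈ P, q x = 0 := fun x ↦ (Submodule.projection_apply_eq_zero_iff hPQ.symm).2
  have hpQ : ∀ x ∈ Q, p x = 0 := fun x ↦ (Submodule.projection_apply_eq_zero_iff hPQ).2
  have hqq : ∀ x ∈ Q, q x = x := fun x ↦ Submodule.projection_apply_of_mem_left hPQ.symm
  refine ⟨1 + N * q, 1 + g * N * p, ?_, ?_, ?_⟩
  · ext x
    simp [hqP _ (hQ _ (hqQ x))]
  · ext x
    simp [hpQ _ (hP _ (hpP x))]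
  · ext x
    have h := hgN (p x)
    have h' : N x = N (p x) + N (q x) := by rw [← map_add, hpq]
    simp only [LinearMap.add_apply, Module.End.mul_apply, Module.End.one_apply, map_add,
      hqq _ (hP _ (hpP x)), h']
    nth_rewrite 1 [← h]
    abel

/-- `x` is a product of two unipotents. -/
def IsProdUnipotent {R : Type*} [Ring R] (x : R) : Prop :=
  ∃ u v : R, IsNilpotent (u - 1) ∧ IsNilpotent (v - 1) ∧ x = u * v

theorem isProdUnipotent_one {R : Type*} [Ring R] : IsProdUnipotent (1 : R) :=
  ⟨1, 1, by simp, by simp, by simp⟩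

theorem IsProdUnipotent.map {R S : Type*} [Ring R] [Ring S] (f : R →+* S) {x : R} :
    IsProdUnipotent x → IsProdUnipotent (f x) := by
  rintro ⟨u, v, hu, hv, rfl⟩
  exact ⟨f u, f v, by simpa using hu.map f, by simpa using hv.map f, by simp⟩

theorem IsNilpotent.conj_sub_one {R : Type*} [Ring R] {u p q : R} (hqp : q * p = 1)
    (hpq : p * q = 1) : IsNilpotent (u - 1) → IsNilpotent (p * u * q - 1) := by
  rintro ⟨k, hk⟩
  have h : p * u * q - 1 = p * (u - 1) * q := by simp [mul_sub, sub_mul, hpq]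
  let P : Rˣ := ⟨p, q, hpq, hqp⟩
  have hP := P.conj_pow (u - 1) k
  rw [hk, mul_zero, zero_mul] at hP
  exact ⟨k, by rw [h]; exact hP⟩

theorem IsProdUnipotent.conj {R : Type*} [Ring R] {x p q : R} (hqp : q * p = 1)
    (hpq : p * q = 1) : IsProdUnipotent x → IsProdUnipotent (p * x * q) := by
  rintro ⟨u, v, hu, hv, rfl⟩
  refine ⟨_, _, hu.conj_sub_one hqp hpq, hv.conj_sub_one hqp hpq, ?_⟩
  calc p * (u * v) * q = p * u * 1 * v * q := by simp only [mul_assoc, one_mul]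
    _ = _ := by rw [← hqp]; simp only [mul_assoc]

namespace Matrix

theorem fromBlocks_sub_one {F m n : Type*} [Ring F] [DecidableEq m] [DecidableEq n]
    (A : Matrix m m F) (B : Matrix m n F) (C : Matrix n m F) (D : Matrix n n F) :
    fromBlocks A B C D - 1 = fromBlocks (A - 1) B C (D - 1) := by
  rw [← fromBlocks_one, sub_eq_add_neg, fromBlocks_neg, fromBlocks_add]
  simp [sub_eq_add_neg]

variable {F : Type*} [Field F] {m n : Type*} [Fintype m] [DecidableEq m] [Fintype n]
  [DecidableEq n]

theorem isProdTwoU2_of_isNilpotent {M : Matrix n n F} (hM : IsNilpotent (M - 1)) :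
    IsProdTwoU2 M := by
  rw [← isProdTwoU2_map_iff (toLinAlgEquiv' (R := F) (n := n)).toRingEquiv]
  apply _root_.isProdTwoU2_of_isNilpotent
  simpa using hM.map (toLinAlgEquiv' (R := F) (n := n))

theorem isNilpotent_fromBlocks_zero₂₁ {A : Matrix m m F} {B : Matrix m n F} {D : Matrix n n F}
    (hA : IsNilpotent A) (hD : IsNilpotent D) : IsNilpotent (fromBlocks A B 0 D) := by
  obtain ⟨k, hk⟩ := hA
  obtain ⟨l, hl⟩ := hD
  have hpow : ∀ j, ∃ C, fromBlocks A B 0 D ^ j = fromBlocks (A ^ j) C 0 (D ^ j) := by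
    intro j
    induction j with
    | zero => exact ⟨0, by simp [fromBlocks_one]⟩
    | succ j ih =>
      obtain ⟨C, hC⟩ := ih
      exact ⟨_, by rw [pow_succ, hC, fromBlocks_multiply]; simp [pow_succ]; rfl⟩
  obtain ⟨C, hC⟩ := hpow k
  obtain ⟨C', hC'⟩ := hpow l
  refine ⟨k + l, ?_⟩
  rw [pow_add, hC, hC', hk, hl, fromBlocks_multiply]
  simp

theorem isNilpotent_fromBlocks_zero₁₂ {A : Matrix m m F} {C : Matrix n m F} {D : Matrix n n F}
    (hA : IsNilpotent A) (hD : IsNilpotent D) : IsNilpotent (fromBlocks A 0 C D) := by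
  have h : fromBlocks A 0 C D =
      reindexAlgEquiv F F (Equiv.sumComm n m) (fromBlocks D C 0 A) := by
    ext (i | i) (j | j) <;> rfl
  rw [h]
  exact (isNilpotent_fromBlocks_zero₂₁ hD hA).map _

theorem isProdUnipotent_fromBlocks_of_sub {r : Matrix m n F} {c : Matrix n m F} {A : Matrix n n F}
    (h : IsProdUnipotent (A - c * r)) : IsProdUnipotent (fromBlocks 1 r c A) := by
  obtain ⟨X, Y, hX, hY, hXY⟩ := h
  refine ⟨fromBlocks 1 0 c X, fromBlocks 1 r 0 Y, ?_, ?_, ?_⟩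
  · rw [fromBlocks_sub_one, sub_self]
    exact isNilpotent_fromBlocks_zero₁₂ .zero hX
  · rw [fromBlocks_sub_one, sub_self]
    exact isNilpotent_fromBlocks_zero₂₁ .zero hY
  · rw [fromBlocks_multiply]
    simp [← hXY]

theorem exists_ne_zero_mul_eq_zero [Nontrivial n] {c : Matrix n Unit F} (hc : c ≠ 0) :
    ∃ g : Matrix Unit n F, g ≠ 0 ∧ g * c = 0 := by
  obtain ⟨i, hi⟩ : ∃ i, c i () ≠ 0 := by
    by_contra! h
    exact hc (by ext i j; exact h i)
  obtain ⟨j, hj⟩ := exists_ne i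
  refine ⟨of fun _ k ↦ (Pi.single i (c j ()) - Pi.single j (c i ()) : n → F) k, ?_, ?_⟩
  · intro h
    have := congrFun (congrFun h ()) j
    simp [hj] at this
    exact hi this
  · ext a b
    simp [mul_apply, sub_mul, Finset.sum_sub_distrib, Pi.single_apply, mul_comm (c j ())]

theorem isProdUnipotent_fromBlocks {r : Matrix Unit n F} {c : Matrix n Unit F}
    {A : Matrix n n F} (hc : c ≠ 0) (hdet : (fromBlocks 1 r c A).det = 1)
    (ih : ∀ B : Matrix n n F, B.det = 1 → (∀ μ : F, B = μ • 1 → B = 1) → IsProdUnipotent B) :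
    IsProdUnipotent (fromBlocks 1 r c A) := by
  rw [det_fromBlocks_one₁₁] at hdet
  by_cases h : ∀ μ : F, A - c * r = μ • 1 → A - c * r = 1
  · exact isProdUnipotent_fromBlocks_of_sub (ih _ hdet h)
  push Not at h
  obtain ⟨μ, hμ, hμ1⟩ := h
  rw [hμ, det_smul, det_one, mul_one] at hdet
  have hcard : Nontrivial n := by
    rw [← Fintype.one_lt_card_iff_nontrivial]
    by_contra! hle
    interval_cases hn : Fintype.card n
    · have := Fintype.card_eq_zero_iff.1 hn
      exact hc (Subsingleton.elim _ _)
    · rw [pow_one] at hdet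
      exact hμ1 (by rw [hμ, hdet, one_smul])
  have hμ0 : μ ≠ 0 := by
    rintro rfl
    rw [zero_pow Fintype.card_ne_zero] at hdet
    exact zero_ne_one hdet
  obtain ⟨g, hg, hgc⟩ := exists_ne_zero_mul_eq_zero hc
  have hA : A = μ • 1 + c * r := by rw [← hμ]; abel
  have hgA : g * A = μ • g := by
    rw [hA, Matrix.mul_add, ← Matrix.mul_assoc, hgc]
    simp
  have hP : (fromBlocks 1 (-g) 0 1 : Matrix (Unit ⊕ n) (Unit ⊕ n) F) * fromBlocks 1 g 0 1 = 1 := by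
    simp [fromBlocks_multiply]
  have hP' : (fromBlocks 1 g 0 1 : Matrix (Unit ⊕ n) (Unit ⊕ n) F) * fromBlocks 1 (-g) 0 1 = 1 := by
    simp [fromBlocks_multiply]
  have hcgc : c * g * c = 0 := by rw [Matrix.mul_assoc, hgc, Matrix.mul_zero]
  have key : IsProdUnipotent (fromBlocks 1 (r + μ • g - g) c (A - c * g)) := by
    have hs : A - c * g - c * (r + μ • g - g) = μ • 1 - μ • (c * g) := by
      rw [hA, Matrix.mul_sub, Matrix.mul_add, Matrix.mul_smul]
      abel
    apply isProdUnipotent_fromBlocks_of_sub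
    apply ih
    · have h1 : (1 - c * g).det = 1 := by
        rw [sub_eq_add_neg, ← Matrix.mul_neg, det_one_add_mul_comm, Matrix.neg_mul, hgc]
        simp
      rw [hs, ← smul_sub, det_smul, h1, hdet, mul_one]
    · intro ν hν
      exfalso
      rw [hs] at hν
      have hνc : μ • c = ν • c := by
        have := congrArg (· * c) hν
        simpa [Matrix.sub_mul, hcgc] using this
      obtain rfl : μ = ν := smul_left_injective F hc hνc
      have hcg : c * g = 0 := by
        rw [sub_eq_self, smul_eq_zero] at hν
        exact hν.resolve_left hμ0
      obtain ⟨i, hi⟩ : ∃ i, c i () ≠ 0 := by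
        by_contra! h
        exact hc (by ext i j; exact h i)
      apply hg
      ext a j
      have := congrFun (congrFun hcg i) j
      simpa [mul_apply, hi] using this
  have := key.conj hP' hP
  convert this
  simp [fromBlocks_multiply, Matrix.mul_add, Matrix.mul_sub, hgA, hgc, ← Matrix.mul_assoc]
  abel

theorem exists_basis_toMatrix_eq {V : Type*} [AddCommGroup V] [Module F V] {k : ℕ}
    [FiniteDimensional F V] (hV : Module.finrank F V = k + 1) {f : Module.End F V}
    (hf : ∀ μ : F, f ≠ μ • 1) :
    ∃ (b : Module.Basis (Unit ⊕ Fin k) F V) (r : Matrix Unit (Fin k) F)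
      (c : Matrix (Fin k) Unit F) (A : Matrix (Fin k) (Fin k) F),
      c ≠ 0 ∧ LinearMap.toMatrix b b f = fromBlocks 1 r c A := by
  obtain ⟨v, hv⟩ : ∃ v, LinearIndependent F ![v, f v] := by
    by_contra! h
    obtain ⟨μ, hμ⟩ := LinearMap.exists_eq_smul_id_of_forall_notLinearIndependent h
    exact hf μ hμ
  rw [LinearIndependent.pair_iff] at hv
  have hnot : v ∉ Submodule.span F {f v - v} := by
    rw [Submodule.mem_span_singleton]
    rintro ⟨a, ha⟩
    have := hv (-a - 1) a (by rw [sub_smul, neg_smul, one_smul]; nth_rewrite 2 [← ha]; module)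
    obtain ⟨h1, rfl⟩ := this
    simp at h1
  obtain ⟨φ₀, hφ₀v, hφ₀⟩ := Submodule.exists_le_ker_of_notMem hnot
  let φ := (φ₀ v)⁻¹ • φ₀
  have hφv : φ v = 1 := by simp [φ, hφ₀v]
  have hφf : φ (f v) = 1 := by
    have : φ₀ (f v - v) = 0 := hφ₀ (Submodule.mem_span_singleton_self _)
    rw [map_sub, sub_eq_zero] at this
    simp [φ, this, hφ₀v]
  have hφ0 : φ ≠ 0 := by
    rintro h
    simp [h] at hφv
  have hker : Module.finrank F (LinearMap.ker φ) = k := by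
    have := Module.Dual.finrank_ker_add_one_of_ne_zero hφ0
    omega
  let b₀ := Module.Basis.mkFinCons v (Module.finBasisOfFinrankEq F (LinearMap.ker φ) hker)
    (fun c x hx h ↦ by
      have := congrArg φ h
      rw [LinearMap.mem_ker] at hx
      simpa [hφv, hx] using this)
    (fun z ↦ ⟨-φ z, by simp [hφv]⟩)
  let e : Fin (k + 1) ≃ Unit ⊕ Fin k :=
    (finSuccEquiv k).trans ((Equiv.optionEquivSumPUnit _).trans (Equiv.sumComm _ _))
  let b := b₀.reindex e
  have hbl : b (Sum.inl ()) = v := by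
    simp [b, b₀, e]
  have hbr : ∀ i, φ (b (Sum.inr i)) = 0 := fun i ↦ by
    simp [b, b₀, e]
  have hcoord : b.coord (Sum.inl ()) = φ := by
    refine b.ext ?_
    rintro (_ | i)
    · rw [hbl, hφv, ← hbl]
      simp
    · simp [hbr]
  refine ⟨b, (LinearMap.toMatrix b b f).toBlocks₁₂, (LinearMap.toMatrix b b f).toBlocks₂₁,
    (LinearMap.toMatrix b b f).toBlocks₂₂, ?_, ?_⟩
  rotate_left
  · rw [← fromBlocks_toBlocks (LinearMap.toMatrix b b f)]
    congr 1
    ext _ _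
    simp [toBlocks₁₁, LinearMap.toMatrix_apply, hbl, ← Module.Basis.coord_apply, hcoord, hφf]
  · intro h
    have hfv : f v = v := by
      apply b.ext_elem
      rintro (_ | i)
      · simp only [← Module.Basis.coord_apply]
        rw [hcoord, hφv, hφf]
      · have := congrFun (congrFun h i) ()
        simp only [toBlocks₂₁, LinearMap.toMatrix_apply, hbl, of_apply, zero_apply] at this
        rw [this, ← hbl]
        simp
    have := hv 1 (-1) (by simp [hfv])
    simp at this

theorem isProdUnipotent_of_det_eq_one (k : ℕ) (A : Matrix (Fin k) (Fin k) F) (hdet : A.det = 1)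
    (hA : ∀ μ : F, A = μ • 1 → A = 1) : IsProdUnipotent A := by
  induction k with
  | zero => exact Subsingleton.elim A 1 ▸ isProdUnipotent_one
  | succ k ih =>
    by_cases h1 : A = 1
    · exact h1 ▸ isProdUnipotent_one
    have hns : ∀ μ : F, toLin' A ≠ μ • 1 := fun μ h ↦ h1 <| hA μ <| by
      apply toLin'.injective
      rw [h, map_smul, toLin'_one]
      rfl
    obtain ⟨b, r, c, A', hc, hM⟩ := exists_basis_toMatrix_eq (k := k) (by simp) hns
    have hM' : IsProdUnipotent (LinearMap.toMatrix b b (toLin' A)) := by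
      rw [hM]
      refine isProdUnipotent_fromBlocks hc ?_ ih
      rw [← hM, LinearMap.det_toMatrix, LinearMap.det_toLin', hdet]
    have := (hM'.map ((LinearMap.toMatrixAlgEquiv b).symm.toRingEquiv : _ →+* _)).map
      (toLinAlgEquiv' (R := F) (n := Fin (k + 1))).symm.toRingEquiv.toRingHom
    have hA' : A = toLinAlgEquiv'.symm ((LinearMap.toMatrixAlgEquiv b).symm
        (LinearMap.toMatrixAlgEquiv b (toLinAlgEquiv' A))) := by simp
    rw [hA']
    exact this

theorem isProdThreeU2_fromBlocks_of_mul {A X Y H : Matrix n n F} (hA : A = X * Y)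
    (hX : IsNilpotent (X - 1)) (hY : IsNilpotent (Y - 1)) (hH : H * (A - 1) = (1 - X) * (1 - Y)) :
    IsProdThreeU2 (fromBlocks A 0 0 1 : Matrix (n ⊕ n) (n ⊕ n) F) := by
  obtain ⟨U, rfl⟩ : IsUnit X := by simpa using hX.isUnit_one_add
  obtain ⟨X, Z, hXZ, hZX⟩ := U
  simp only at *
  have h1 : IsProdTwoU2 (fromBlocks (X * Y * Z) A 0 X) := by
    apply isProdTwoU2_of_isNilpotent
    rw [fromBlocks_sub_one]
    exact isNilpotent_fromBlocks_zero₂₁ (hY.conj_sub_one hZX hXZ) hX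
  obtain ⟨K, hK⟩ : ∃ K, K = Y - X * Y + X - 1 := ⟨_, rfl⟩
  have h2 : IsProdTwoU2 (fromBlocks A A K (1 + K)) := by
    convert h1.conj (p := fromBlocks 1 0 (Z - 1) 1) (q := fromBlocks 1 0 (1 - Z) 1)
      (by simp [fromBlocks_multiply]) (by simp [fromBlocks_multiply]) using 1
    have e : (Z - 1) * (X * Y) = Y - X * Y := by
      rw [sub_mul, ← mul_assoc, hZX, one_mul, one_mul]
    rw [fromBlocks_multiply, fromBlocks_multiply, ← mul_assoc (Z - 1), hA, e, hK]
    congr 1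
    · noncomm_ring
    · simp
    · simp [mul_sub, add_mul, sub_mul, hXZ]
      abel
    · simp
  have h3 : IsProdThreeU2 (fromBlocks A 0 K 1 : Matrix (n ⊕ n) (n ⊕ n) F) := by
    convert h2.mul (w := fromBlocks 1 (-1) 0 1) (by
      rw [IsU2, fromBlocks_sub_one]
      simp [fromBlocks_multiply]) using 1
    simp [fromBlocks_multiply]
  convert h3.conj (p := fromBlocks 1 0 H 1) (q := fromBlocks 1 0 (-H) 1)
    (by simp [fromBlocks_multiply]) (by simp [fromBlocks_multiply]) using 1
  have hHA : H * A = H - K := by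
    rw [← sub_add_cancel (H * A) H, ← mul_sub_one, hH, hK]; noncomm_ring
  simp [fromBlocks_multiply, hHA]

theorem isProdThreeU2_fromBlocks_fromBlocks {E : Matrix m n F} {B : Matrix n n F}
    {G : Matrix n m F} {H : Matrix n n F} (hinj : G * E + H * (B - 1) = 1)
    (hB : IsProdUnipotent B) :
    IsProdThreeU2 (fromBlocks (fromBlocks 1 E 0 B) 0 0 1 :
      Matrix ((m ⊕ n) ⊕ (m ⊕ n)) ((m ⊕ n) ⊕ (m ⊕ n)) F) := by
  obtain ⟨X, Y, hX, hY, rfl⟩ := hB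
  obtain ⟨U, rfl⟩ : IsUnit Y := by simpa using hY.isUnit_one_add
  obtain ⟨Y, Z, hYZ, hZY⟩ := U
  simp only at *
  refine isProdThreeU2_fromBlocks_of_mul (X := fromBlocks 1 (E * Z) 0 X)
    (Y := fromBlocks 1 0 0 Y)
    (H := fromBlocks 0 (-(E * Z) * (1 - Y)) 0 ((1 - X) * (1 - Y)) * fromBlocks 0 0 G H)
    ?_ ?_ ?_ ?_
  · simp [fromBlocks_multiply, Matrix.mul_assoc, hZY]
  · rw [fromBlocks_sub_one]
    exact isNilpotent_fromBlocks_zero₂₁ (by simp) hX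
  · rw [fromBlocks_sub_one]
    exact isNilpotent_fromBlocks_zero₂₁ (by simp) hY
  · have h : ∀ (A : Matrix m m F) (B : Matrix m n F) (C : Matrix n m F) (D : Matrix n n F),
        1 - fromBlocks A B C D =
        fromBlocks (1 - A) (-B) (-C) (1 - D) := fun A B C D ↦ by
      rw [← neg_sub, fromBlocks_sub_one, fromBlocks_neg, neg_sub, neg_sub]
    have h0 : fromBlocks 0 0 G H * ((fromBlocks 1 E 0 (X * Y) : Matrix (m ⊕ n) (m ⊕ n) F) - 1) =
        (fromBlocks 0 0 0 1 : Matrix (m ⊕ n) (m ⊕ n) F) := by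
      rw [fromBlocks_sub_one, fromBlocks_multiply]
      simp [hinj]
    rw [Matrix.mul_assoc, h0, h, h]
    simp [fromBlocks_multiply]

theorem toMatrixAlgEquiv_prodMap_one {V : Type*} [AddCommGroup V] [Module F V]
    (f : Module.End F V) (b : Module.Basis m F V) :
    LinearMap.toMatrixAlgEquiv (b.prod b) (f.prodMap 1) =
      fromBlocks (LinearMap.toMatrix b b f) 0 0 1 := by
  have := LinearMap.toMatrix_prodMap b b f 1
  rwa [LinearMap.toMatrix_one] at this

theorem isProdThreeU2_toMatrix {V : Type*} [AddCommGroup V] [Module F V]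
    (f : Module.End F V) (b : Module.Basis m F V) (b' : Module.Basis n F V)
    (h : IsProdThreeU2 (fromBlocks (LinearMap.toMatrix b b f) 0 0 1 : Matrix (m ⊕ m) (m ⊕ m) F)) :
    IsProdThreeU2 (fromBlocks (LinearMap.toMatrix b' b' f) 0 0 1 : Matrix (n ⊕ n) (n ⊕ n) F) := by
  rw [← toMatrixAlgEquiv_prodMap_one] at h ⊢
  exact (isProdThreeU2_map_iff (LinearMap.toMatrixAlgEquiv (b'.prod b')).toRingEquiv).2
    ((isProdThreeU2_map_iff (LinearMap.toMatrixAlgEquiv (b.prod b)).toRingEquiv).1 h)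

theorem exists_basis_toMatrix_mulLeft {B : Type*} [CommRing B] [Algebra F B] (pb : PowerBasis F B)
    {r : ℕ} (hr : 0 < r) (hdim : pb.dim = r + r) (hgen : pb.gen ^ (r + r) = -1) {μ : F}
    (hμ : μ ^ r = 1) :
    ∃ (b : Module.Basis (Fin r ⊕ Fin r) F B) (T : Matrix (Fin r) (Fin r) F),
      LinearMap.toMatrix b b (LinearMap.mulLeft F pb.gen) = fromBlocks 0 (-(μ • 1)) 1 T := by
  obtain ⟨η, hη⟩ : ∃ η, pb.gen * η = 1 :=
    ⟨-pb.gen ^ (r + r - 1), by rw [mul_neg, mul_pow_sub_one (by omega), hgen, neg_neg]⟩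
  set θ := pb.gen with hθ
  set c := algebraMap F B μ with hc
  have hcr : c ^ r = 1 := by rw [hc, ← map_pow, hμ, map_one]
  let β : ℕ → B := fun k ↦ θ ^ k + c ^ k * η ^ k
  have hβr : β r = 0 := by
    have h : θ ^ r * η ^ r = 1 := by rw [← mul_pow, hη, one_pow]
    have h' : η ^ r * (θ ^ (r + r) + 1) = 0 := by rw [hgen]; ring
    calc β r = θ ^ r + η ^ r := by simp [β, hcr]
      _ = η ^ r * (θ ^ (r + r) + 1) + θ ^ r * (1 - θ ^ r * η ^ r) := by ring
      _ = 0 := by rw [h, h']; ring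
  let α : Fin r → B := fun i ↦ if i = (⟨0, hr⟩ : Fin r) then 1 else β i
  have hα0 : α ⟨0, hr⟩ = 1 := if_pos rfl
  let S := Submodule.span F (Set.range α)
  have hαS : ∀ i, α i ∈ S := fun i ↦ Submodule.subset_span ⟨i, rfl⟩
  have hβS : ∀ k ≤ r, β k ∈ S := by
    intro k hk
    rcases Nat.eq_zero_or_pos k with rfl | hk0
    · have : β 0 = α ⟨0, hr⟩ + α ⟨0, hr⟩ := by simp [β, hα0]
      rw [this]
      exact S.add_mem (hαS _) (hαS _)
    rcases hk.eq_or_lt with rfl | hk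
    · rw [hβr]; exact S.zero_mem
    · have : β k = α ⟨k, hk⟩ := by simp [α, hk0.ne']
      rw [this]
      exact hαS _
  have hσ : ∀ i, (θ + c * η) * α i ∈ S := by
    rintro ⟨i, hi⟩
    rcases Nat.eq_zero_or_pos i with rfl | hi0
    · rw [hα0]
      simpa [β] using hβS 1 hr
    · obtain ⟨j, rfl⟩ : ∃ j, i = j + 1 := ⟨i - 1, by omega⟩
      have : (θ + c * η) * α ⟨j + 1, hi⟩ = β (j + 2) + μ • β j := by
        simp only [α, β, Fin.mk.injEq, hi0.ne', if_false, Algebra.smul_def, ← hc]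
        linear_combination (c ^ (j + 1) * η ^ j + c * θ ^ j) * hη
      rw [this]
      exact S.add_mem (hβS _ hi) (S.smul_mem _ (hβS _ (by omega)))
  choose T hT using fun i ↦ Submodule.mem_span_range_iff_exists_fun F |>.1 (hσ i)
  let v : Fin r ⊕ Fin r → B := Sum.elim α fun i ↦ θ * α i
  have hθθ : ∀ i, θ * (θ * α i) = ∑ j, T i j • (θ * α j) - μ • α i := fun i ↦ by
    simp only [← mul_smul_comm, ← Finset.mul_sum]
    rw [hT, Algebra.smul_def, ← hc]
    linear_combination (-c * α i) * hη
  have hspan : ⊤ ≤ Submodule.span F (Set.range v) := by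
    have hv : ∀ i, v i ∈ Submodule.span F (Set.range v) := fun i ↦ Submodule.subset_span ⟨i, rfl⟩
    have hmul : Submodule.span F (Set.range v) ≤
        (Submodule.span F (Set.range v)).comap (LinearMap.mulLeft F θ) := by
      rw [Submodule.span_le]
      rintro _ ⟨i | i, rfl⟩
      · exact hv (Sum.inr i)
      · change θ * (θ * α i) ∈ Submodule.span F (Set.range v)
        rw [hθθ]
        exact Submodule.sub_mem _
          (Submodule.sum_mem _ fun j _ ↦ Submodule.smul_mem _ _ (hv (Sum.inr j)))
          (Submodule.smul_mem _ _ (hv (Sum.inl i)))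
    rw [← pb.basis.span_eq, Submodule.span_le]
    rintro _ ⟨i, rfl⟩
    rw [pb.coe_basis]
    change θ ^ (i : ℕ) ∈ Submodule.span F (Set.range v)
    induction (i : ℕ) with
    | zero => simpa [v, hα0] using hv (Sum.inl ⟨0, hr⟩)
    | succ k ih => rw [pow_succ']; exact hmul ih
  have hcard : Fintype.card (Fin r ⊕ Fin r) = Module.finrank F B := by
    rw [pb.finrank, hdim]; simp
  let b := basisOfTopLeSpanOfCardEqFinrank v hspan hcard
  have hb : ∀ i, b i = v i := fun i ↦ by simp [b]
  refine ⟨b, of fun j i ↦ T i j, ?_⟩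
  rw [← LinearEquiv.eq_symm_apply, LinearMap.toMatrix_symm]
  refine b.ext ?_
  rintro (i | i)
  · rw [toLin_self]
    simp [hb, v, one_apply]
  · rw [toLin_self]
    simp [hb, v, hθθ, one_apply]
    abel

theorem isProdThreeU2_fromBlocks_smul_one (r : ℕ) {μ : F} (hμ : μ ^ r = 1) :
    IsProdThreeU2 (fromBlocks (μ • 1) 0 0 1 : Matrix (Fin r ⊕ Fin r) (Fin r ⊕ Fin r) F) := by
  by_cases hμ1 : μ = 1
  · exact ⟨1, 1, 1, isU2_one, isU2_one, isU2_one, by simp [hμ1]⟩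
  rcases Nat.eq_zero_or_pos r with rfl | hr
  · exact ⟨1, 1, 1, isU2_one, isU2_one, isU2_one, Subsingleton.elim _ _⟩
  let p : Polynomial F := Polynomial.X ^ (r + r) + 1
  have hp : p.natDegree = r + r := Polynomial.natDegree_X_pow_add_C (r := 1)
  have hm : p.Monic := Polynomial.monic_X_pow_add_C 1 (by omega)
  let pb := AdjoinRoot.powerBasis' hm
  have hgen : pb.gen ^ (r + r) = -1 := by
    have := AdjoinRoot.eval₂_root p
    simp only [p, Polynomial.eval₂_add, Polynomial.eval₂_pow, Polynomial.eval₂_X,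
      Polynomial.eval₂_one] at this
    exact eq_neg_of_add_eq_zero_left this
  obtain ⟨b₁, T₁, h₁⟩ := exists_basis_toMatrix_mulLeft pb hr hp hgen (one_pow r : (1 : F) ^ r = 1)
  obtain ⟨b, T, h⟩ := exists_basis_toMatrix_mulLeft pb hr hp hgen hμ
  have hf : IsProdTwoU2 (LinearMap.mulLeft F pb.gen) := by
    rw [← isProdTwoU2_map_iff (LinearMap.toMatrixAlgEquiv b₁).toRingEquiv]
    change IsProdTwoU2 (LinearMap.toMatrix b₁ b₁ _)
    rw [h₁]
    refine ⟨fromBlocks 1 0 (2 - T₁) 1, fromBlocks 0 (-1) 1 2, ?_, ?_, ?_⟩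
    · rw [IsU2, fromBlocks_sub_one]; simp [fromBlocks_multiply]
    · rw [IsU2, fromBlocks_sub_one]; simp [fromBlocks_multiply]; norm_num
    · simp [fromBlocks_multiply]
  have h2 : IsProdThreeU2 (fromBlocks (μ • 1) 0 (2 - T) 1 :
      Matrix (Fin r ⊕ Fin r) (Fin r ⊕ Fin r) F) := by
    rw [← isProdTwoU2_map_iff (LinearMap.toMatrixAlgEquiv b).toRingEquiv] at hf
    change IsProdTwoU2 (LinearMap.toMatrix b b _) at hf
    rw [h] at hf
    convert hf.mul (w := fromBlocks 2 1 (-1) 0) ?_ using 1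
    · simp [fromBlocks_multiply, sub_eq_add_neg]
    · rw [IsU2, fromBlocks_sub_one]; simp [fromBlocks_multiply]; norm_num
  have hμ' : μ - 1 ≠ 0 := sub_ne_zero.2 hμ1
  obtain ⟨Y, hY⟩ : ∃ Y, Y = -(μ - 1)⁻¹ • (2 - T) := ⟨_, rfl⟩
  have hY' : μ • Y - Y = -(2 - T) := by
    have h : (μ - 1) • Y = -(2 - T) := by rw [hY, neg_smul, smul_neg, smul_inv_smul₀ hμ']
    rwa [sub_smul, one_smul] at h
  have hY0 : μ • Y + (2 - T) + -Y = 0 := by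
    rw [add_right_comm, ← sub_eq_add_neg, hY', neg_add_cancel]
  convert h2.conj (p := fromBlocks 1 0 Y 1) (q := fromBlocks 1 0 (-Y) 1)
    (by simp [fromBlocks_multiply]) (by simp [fromBlocks_multiply]) using 1
  simp [fromBlocks_multiply, hY0]

theorem _root_.IsProdThreeU2.fromBlocks_one {N : Matrix n n F} :
    IsProdThreeU2 N → IsProdThreeU2 (fromBlocks 1 0 0 N : Matrix (m ⊕ n) (m ⊕ n) F) := by
  have h : ∀ {u : Matrix n n F}, IsU2 u → IsU2 (fromBlocks 1 0 0 u : Matrix (m ⊕ n) (m ⊕ n) F) := by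
    intro u hu
    rw [IsU2] at hu
    rw [IsU2, fromBlocks_sub_one]
    simp [fromBlocks_multiply, hu]
  rintro ⟨u, v, w, hu, hv, hw, rfl⟩
  exact ⟨_, _, _, h hu, h hv, h hw, by simp [fromBlocks_multiply]⟩

theorem isProdThreeU2_fromBlocks_fromBlocks_smul_one {r : ℕ} {μ : F} (hμ : μ ^ r = 1)
    (hμ1 : μ ≠ 1) (E : Matrix m (Fin r) F) :
    IsProdThreeU2 (fromBlocks (fromBlocks 1 E 0 (μ • 1)) 0 0 1 :
      Matrix ((m ⊕ Fin r) ⊕ (m ⊕ Fin r)) ((m ⊕ Fin r) ⊕ (m ⊕ Fin r)) F) := by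
  have h : IsProdThreeU2 (fromBlocks (fromBlocks 1 0 0 (μ • 1)) 0 0 1 :
      Matrix ((m ⊕ Fin r) ⊕ (m ⊕ Fin r)) ((m ⊕ Fin r) ⊕ (m ⊕ Fin r)) F) := by
    convert (isProdThreeU2_fromBlocks_smul_one r hμ).fromBlocks_one (m := m ⊕ m) |>.map
      (reindexAlgEquiv F F (Equiv.sumSumSumComm m m (Fin r) (Fin r))).toRingEquiv.toRingHom using 1
    ext ((i | i) | (i | i)) ((j | j) | (j | j)) <;> simp [one_apply]
  obtain ⟨X, hX⟩ : ∃ X, X = (μ - 1)⁻¹ • E := ⟨_, rfl⟩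
  have hXE : -X + μ • X = E := by
    have h : (μ - 1) • X = E := by rw [hX, smul_inv_smul₀ (sub_ne_zero.2 hμ1)]
    rwa [sub_smul, one_smul, sub_eq_neg_add] at h
  convert h.conj (p := fromBlocks (fromBlocks 1 X 0 1) 0 0 1)
    (q := fromBlocks (fromBlocks 1 (-X) 0 1) 0 0 1)
    (by simp [fromBlocks_multiply]) (by simp [fromBlocks_multiply]) using 1
  simp [fromBlocks_multiply, hXE]

theorem isProdThreeU2_fromBlocks_of_det_eq_one {r : ℕ} {E : Matrix m (Fin r) F}
    {B : Matrix (Fin r) (Fin r) F} (hB : B.det = 1)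
    (hinj : ∀ x, E *ᵥ x = 0 → B *ᵥ x = x → x = 0) :
    IsProdThreeU2 (fromBlocks (fromBlocks 1 E 0 B) 0 0 1 :
      Matrix ((m ⊕ Fin r) ⊕ (m ⊕ Fin r)) ((m ⊕ Fin r) ⊕ (m ⊕ Fin r)) F) := by
  by_cases hs : ∀ μ : F, B = μ • 1 → B = 1
  · obtain ⟨g, hg⟩ := LinearMap.exists_leftInverse_of_injective (toLin' (fromRows E (B - 1))) <| by
      rw [LinearMap.ker_eq_bot']
      intro x hx
      rw [toLin'_apply, fromRows_mulVec, ← Sum.elim_zero_zero] at hx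
      refine hinj x (funext fun i ↦ congrFun hx (Sum.inl i)) (sub_eq_zero.1 ?_)
      simpa [sub_mulVec] using (funext fun i ↦ congrFun hx (Sum.inr i) : (B - 1) *ᵥ x = 0)
    have hG : fromCols (LinearMap.toMatrix' g).toCols₁ (LinearMap.toMatrix' g).toCols₂ *
        fromRows E (B - 1) = 1 := by
      rw [fromCols_toCols, ← LinearMap.toMatrix'_toLin' (fromRows E (B - 1)),
        ← LinearMap.toMatrix'_comp, hg, LinearMap.toMatrix'_id]
    rw [fromCols_mul_fromRows] at hG
    exact isProdThreeU2_fromBlocks_fromBlocks hG (isProdUnipotent_of_det_eq_one r B hB hs)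
  · push Not at hs
    obtain ⟨μ, rfl, hμ⟩ := hs
    exact isProdThreeU2_fromBlocks_fromBlocks_smul_one (by simpa using hB)
      (by rintro rfl; simp at hμ) E

theorem isProdThreeU2_fromBlocks_zero_zero_one {k : ℕ} {A : Matrix (Fin k) (Fin k) F}
    (hdet : A.det = 1) :
    IsProdThreeU2 (fromBlocks A 0 0 1 : Matrix (Fin k ⊕ Fin k) (Fin k ⊕ Fin k) F) := by
  let f := toLin' A
  obtain ⟨W, hW⟩ := (LinearMap.ker (f - 1)).exists_isCompl
  let c := Module.finBasis F W
  let b := ((Module.finBasis F (LinearMap.ker (f - 1))).prod c).map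
    (Submodule.prodEquivOfIsCompl _ W hW)
  obtain ⟨E, B, hM⟩ : ∃ E B, LinearMap.toMatrix b b f = fromBlocks 1 E 0 B := by
    refine ⟨(LinearMap.toMatrix b b f).toBlocks₁₂, (LinearMap.toMatrix b b f).toBlocks₂₂, ?_⟩
    have hf : ∀ j, f (b (Sum.inl j)) = b (Sum.inl j) := fun j ↦ by
      have : b (Sum.inl j) ∈ LinearMap.ker (f - 1) := by simp [b]
      simpa [sub_eq_zero] using this
    conv_lhs => rw [← fromBlocks_toBlocks (LinearMap.toMatrix b b f)]
    congr 1
    · ext i j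
      simp [toBlocks₁₁, LinearMap.toMatrix_apply, hf, one_apply, Finsupp.single_apply, eq_comm]
    · ext i j
      simp [toBlocks₂₁, LinearMap.toMatrix_apply, hf]
  have hB : B.det = 1 := by
    have h : (LinearMap.toMatrix b b f).det = 1 := by
      rw [LinearMap.det_toMatrix, LinearMap.det_toLin', hdet]
    simpa [hM] using h
  have hinj : ∀ x, E *ᵥ x = 0 → B *ᵥ x = x → x = 0 := by
    intro x hE hBx
    obtain ⟨w, rfl⟩ := c.equivFun.surjective x
    have hw : ⇑(b.repr w) = Sum.elim (0 : Fin _ → F) (c.equivFun w) := by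
      ext (i | i) <;> simp [b]
    have hfw : f w = w := by
      apply b.repr.injective
      apply DFunLike.coe_injective
      rw [← LinearMap.toMatrix_mulVec_repr b b f, hM, hw, fromBlocks_mulVec]
      rw [Sum.elim_comp_inl, Sum.elim_comp_inr, hE, hBx]
      simp
    have h0 : (w : Fin k → F) = 0 := by
      refine (Submodule.disjoint_def.1 hW.disjoint) w ?_ w.2
      simp [hfw]
    simpa using h0
  have h := isProdThreeU2_toMatrix f b (Pi.basisFun F (Fin k)) <| by
    rw [hM]
    exact isProdThreeU2_fromBlocks_of_det_eq_one hB hinj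
  rwa [LinearMap.toMatrix_eq_toMatrix', LinearMap.toMatrix'_toLin'] at h

end Matrix

theorem stmt1 {F : Type*} [Field F] {n : ℕ} (hn : 0 < n)
    (A : Matrix (Fin n) (Fin n) F) (hA : IsUnit A)
    (hdet : A.det = 1) :
    ∃ U₁ U₂ U₃ : Matrix (Fin (n + n)) (Fin (n + n)) F,
      (U₁ - 1) * (U₁ - 1) = 0 ∧ (U₂ - 1) * (U₂ - 1) = 0 ∧ (U₃ - 1) * (U₃ - 1) = 0 ∧
      Matrix.reindex finSumFinEquiv finSumFinEquiv
        (Matrix.fromBlocks A 0 0 (1 : Matrix (Fin n) (Fin n) F)) = U₁ * U₂ * U₃ :=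
  (Matrix.isProdThreeU2_fromBlocks_zero_zero_one hdet).map
    (Matrix.reindexAlgEquiv F F finSumFinEquiv).toRingEquiv.toRingHom
end
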